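/- arXiv:2304.04690 — 2 statements merged into one kernel-verified Lean document; each statement's English description precedes it below -/
import Mathlib

section
/- Let k ≥ 1 and let D be the directed Hajós join of two digraphs D1 and D2. Then D is k-extremal if and only if both D1 and D2 are k-extremal. -/
/-!
Common framework: finite digraphs on vertex set a `Finset ℕ`,
loopless and without parallel arcs (arcs are a `Finset (ℕ × ℕ)`).
-/

structure Dgraph where
  verts : Finset ℕ
  arcs : Finset (ℕ × ℕ)

namespace Dgraph

/-- Well-formedness: every arc joins two distinct vertices of the digraph
(no loops, arcs within the vertex set). -/
def WF (D : Dgraph) : Prop :=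
  ∀ a ∈ D.arcs, a.1 ∈ D.verts ∧ a.2 ∈ D.verts ∧ a.1 ≠ a.2

/-- `p` is a directed path from `u` to `v` in `D` (vertices pairwise distinct,
consecutive pairs are arcs). -/
def IsDipath (D : Dgraph) (p : List ℕ) (u v : ℕ) : Prop :=
  p.Nodup ∧ p.head? = some u ∧ p.getLast? = some v ∧
    (∀ x ∈ p, x ∈ D.verts) ∧ p.Chain' (fun a b => (a, b) ∈ D.arcs)

/-- The set of arcs used by a path (consecutive pairs). -/
def arcsOf (p : List ℕ) : Finset (ℕ × ℕ) := (p.zip p.tail).toFinset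

/-- Local arc-connectivity `λ(u,v)`: the maximum number of pairwise
arc-disjoint directed paths from `u` to `v`. -/
noncomputable def locLam (D : Dgraph) (u v : ℕ) : ℕ :=
  sSup {n | ∃ P : Fin n → List ℕ, (∀ i, D.IsDipath (P i) u v) ∧
    Pairwise fun i j => Disjoint (arcsOf (P i)) (arcsOf (P j))}

/-- Maximum local arc-connectivity `λ(D)`. -/
noncomputable def lam (D : Dgraph) : ℕ :=
  sSup {n | ∃ u ∈ D.verts, ∃ v ∈ D.verts, u ≠ v ∧ n = D.locLam u v}

/-- `p` is a directed cycle of `D` (cyclically consecutive pairs are arcs,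
vertices pairwise distinct). -/
def IsDicycle (D : Dgraph) (p : List ℕ) : Prop :=
  2 ≤ p.length ∧ p.Nodup ∧ (∀ x ∈ p, x ∈ D.verts) ∧
    p.Chain' (fun a b => (a, b) ∈ D.arcs) ∧
    ∀ x y, p.getLast? = some x → p.head? = some y → (x, y) ∈ D.arcs

/-- A colouring `φ` of the vertices with `k` colours is a `k`-dicolouring if
no directed cycle is monochromatic, i.e. every colour class induces an
acyclic subdigraph. -/
def IsDicolouring (D : Dgraph) (k : ℕ) (φ : ℕ → Fin k) : Prop :=
  ∀ p, D.IsDicycle p → ¬∃ c, ∀ x ∈ p, φ x = c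

/-- The dichromatic number: least `k` admitting a `k`-dicolouring. -/
noncomputable def dichi (D : Dgraph) : ℕ :=
  sInf {k | ∃ φ : ℕ → Fin k, D.IsDicolouring k φ}

/-- A monochromatic list of vertices. -/
def Mono {k : ℕ} (φ : ℕ → Fin k) (p : List ℕ) : Prop := ∃ c, ∀ x ∈ p, φ x = c

/-- `D` is strong: any vertex can reach any other by a directed path. -/
def Strong (D : Dgraph) : Prop :=
  ∀ u ∈ D.verts, ∀ v ∈ D.verts, u ≠ v → ∃ p, D.IsDipath p u v

/-- Induced subdigraph on `S`. -/
def induce (D : Dgraph) (S : Finset ℕ) : Dgraph where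
  verts := D.verts ∩ S
  arcs := D.arcs.filter fun a => a.1 ∈ S ∧ a.2 ∈ S

/-- Adjacency in the underlying undirected graph. -/
def adj (D : Dgraph) (x y : ℕ) : Prop := (x, y) ∈ D.arcs ∨ (y, x) ∈ D.arcs

/-- Reachability in the underlying undirected graph. -/
def UReach (D : Dgraph) (x y : ℕ) : Prop := Relation.ReflTransGen D.adj x y

/-- Connectivity of the underlying undirected graph. -/
def UConnected (D : Dgraph) : Prop :=
  D.verts.Nonempty ∧ ∀ u ∈ D.verts, ∀ v ∈ D.verts, D.UReach u v

/-- Deletion of a vertex. -/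
def delVert (D : Dgraph) (v : ℕ) : Dgraph := D.induce (D.verts.erase v)

/-- `v` is a cutvertex: its removal disconnects the underlying graph. -/
def IsCutvertex (D : Dgraph) (v : ℕ) : Prop :=
  v ∈ D.verts ∧ ¬(D.delVert v).UConnected

/-- Biconnected: the underlying graph is connected and has no cutvertex. -/
def Biconnected (D : Dgraph) : Prop :=
  D.UConnected ∧ ∀ v, ¬D.IsCutvertex v

/-- `D` is `k`-extremal: biconnected, strong and `χ⃗(D) = λ(D) + 1 = k + 1`. -/
def Extremal (k : ℕ) (D : Dgraph) : Prop :=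
  D.Biconnected ∧ D.Strong ∧ D.dichi = k + 1 ∧ D.lam = k

/-- The arcs of the dicut `(X, X̄)`: arcs from `X` to its complement. -/
def dicutArcs (D : Dgraph) (X : Finset ℕ) : Finset (ℕ × ℕ) :=
  D.arcs.filter fun a => a.1 ∈ X ∧ a.2 ∉ X

/-- `X` is the side of a dicut: `∅ ≠ X ⊊ V(D)`. -/
def IsDicutSide (D : Dgraph) (X : Finset ℕ) : Prop :=
  X ⊆ D.verts ∧ X.Nonempty ∧ X ≠ D.verts

/-- `(X, X̄)` is a minimum dicut of `D`. -/
def IsMinDicut (D : Dgraph) (X : Finset ℕ) : Prop :=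
  D.IsDicutSide X ∧ ∀ Y, D.IsDicutSide Y → (D.dicutArcs X).card ≤ (D.dicutArcs Y).card

def outdeg (D : Dgraph) (v : ℕ) : ℕ := (D.arcs.filter fun a => a.1 = v).card
def indeg (D : Dgraph) (v : ℕ) : ℕ := (D.arcs.filter fun a => a.2 = v).card

/-- Eulerian: every vertex has equal in- and out-degree. -/
def Eulerian (D : Dgraph) : Prop := ∀ v ∈ D.verts, D.outdeg v = D.indeg v

/-- Deleting a set of arcs. -/
def delArcs (D : Dgraph) (s : Finset (ℕ × ℕ)) : Dgraph := ⟨D.verts, D.arcs \ s⟩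

/-- Adding an arc. -/
def addArc (D : Dgraph) (u v : ℕ) : Dgraph :=
  ⟨insert u (insert v D.verts), insert (u, v) D.arcs⟩

/-- `D` is `m`-dicritical: `χ⃗(D) = m` and deleting any arc drops the
dichromatic number to at most `m - 1`. -/
def Dicritical (m : ℕ) (D : Dgraph) : Prop :=
  D.dichi = m ∧ ∀ a ∈ D.arcs, (D.delArcs {a}).dichi ≤ m - 1

/-- Renaming a vertex `x` to `y`. -/
def ren (x y z : ℕ) : ℕ := if z = x then y else z

def renArc (x y : ℕ) (a : ℕ × ℕ) : ℕ × ℕ := (ren x y a.1, ren x y a.2)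

/-- Cyclically consecutive pairs of a list: the arcs of the directed cycle
through `p` in this cyclic order. -/
def cycArcs (p : List ℕ) : Finset (ℕ × ℕ) := (p.zip (p.rotate 1)).toFinset

/-- `D` is a directed cycle. -/
def IsDirectedCycleGraph (D : Dgraph) : Prop :=
  ∃ p : List ℕ, 2 ≤ p.length ∧ p.Nodup ∧ D.verts = p.toFinset ∧ D.arcs = cycArcs p

/-- `D` is the bidirected complete digraph `↔K_n`. -/
def IsBiComplete (D : Dgraph) (n : ℕ) : Prop :=
  D.verts.card = n ∧ D.arcs = (D.verts ×ˢ D.verts).filter fun a => a.1 ≠ a.2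

/-- Arcs of a bidirected (symmetric) cycle through `p`. -/
def symmCyc (p : List ℕ) : Finset (ℕ × ℕ) := cycArcs p ∪ (cycArcs p).image Prod.swap

/-- `D` is a symmetric odd wheel: a bidirected odd cycle (≥ 3 vertices)
plus a hub joined by digons to all cycle vertices. -/
def IsSymOddWheel (D : Dgraph) : Prop :=
  ∃ (p : List ℕ) (x : ℕ), 3 ≤ p.length ∧ Odd p.length ∧ p.Nodup ∧ x ∉ p ∧
    D.verts = insert x p.toFinset ∧
    D.arcs = symmCyc p ∪ p.toFinset.image (fun y => (x, y)) ∪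
      p.toFinset.image (fun y => (y, x))

/-- A fresh vertex not in `D`. -/
def fresh (D : Dgraph) : ℕ := (D.verts.sup id) + 1

/-- Contraction `D/X`: `X` is contracted into a single new vertex; arcs
inside `X` are deleted and parallel arcs created by contraction are
identified. -/
def contract (D : Dgraph) (X : Finset ℕ) : Dgraph where
  verts := insert (fresh D) (D.verts \ X)
  arcs := (D.arcs.image fun a =>
      (if a.1 ∈ X then fresh D else a.1, if a.2 ∈ X then fresh D else a.2)).filter
      fun a => a.1 ≠ a.2

/-- `D` is the directed Hajós join of `D1` and `D2` with respect to the arcs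
`(u,v1) ∈ A(D1)` and `(v2,w) ∈ A(D2)`, the vertices `v1, v2` being
identified into the new vertex `v`, and the arc `(u,w)` being added. -/
def IsDirHajosJoinAt (D D1 D2 : Dgraph) (u v1 v2 w v : ℕ) : Prop :=
  D1.WF ∧ D2.WF ∧ Disjoint D1.verts D2.verts ∧
  (u, v1) ∈ D1.arcs ∧ (v2, w) ∈ D2.arcs ∧
  v ∉ (D1.verts.erase v1) ∪ (D2.verts.erase v2) ∧
  D.verts = insert v ((D1.verts.erase v1) ∪ (D2.verts.erase v2)) ∧
  D.arcs = insert (u, w)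
    (((D1.arcs.erase (u, v1)) ∪ (D2.arcs.erase (v2, w))).image
      fun a => renArc v2 v (renArc v1 v a))

def IsDirHajosJoin (D D1 D2 : Dgraph) : Prop :=
  ∃ u v1 v2 w v, IsDirHajosJoinAt D D1 D2 u v1 v2 w v

/-- Bidirected Hajós join with respect to the digons `[u,v1] ⊆ A(D1)` and
`[w,v2] ⊆ A(D2)`. -/
def IsBidirHajosJoinAt (D D1 D2 : Dgraph) (u v1 v2 w v : ℕ) : Prop :=
  D1.WF ∧ D2.WF ∧ Disjoint D1.verts D2.verts ∧
  (u, v1) ∈ D1.arcs ∧ (v1, u) ∈ D1.arcs ∧ (w, v2) ∈ D2.arcs ∧ (v2, w) ∈ D2.arcs ∧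
  v ∉ (D1.verts.erase v1) ∪ (D2.verts.erase v2) ∧
  D.verts = insert v ((D1.verts.erase v1) ∪ (D2.verts.erase v2)) ∧
  D.arcs = insert (u, w) (insert (w, u)
    (((D1.arcs \ {(u, v1), (v1, u)}) ∪ (D2.arcs \ {(w, v2), (v2, w)})).image
      fun a => renArc v2 v (renArc v1 v a)))

def IsBidirHajosJoin (D D1 D2 : Dgraph) : Prop :=
  ∃ u v1 v2 w v, IsBidirHajosJoinAt D D1 D2 u v1 v2 w v

/-- Hajós bijoin of `D1` and `D2` with respect to `((t,a1,w),(v,a2,u))`: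
`ta1, a1w ∈ A(D1)` with `t,w` in the same connected component of `D1 ∖ a1`,
`va2, a2u ∈ A(D2)` with `u,v` in the same connected component of `D2 ∖ a2`;
`a1` and `a2` are identified into the new vertex `a` and the arcs
`tu` and `vw` are added. -/
def IsHajosBijoinAt (D D1 D2 : Dgraph) (t a1 w v a2 u a : ℕ) : Prop :=
  D1.WF ∧ D2.WF ∧ Disjoint D1.verts D2.verts ∧
  (t, a1) ∈ D1.arcs ∧ (a1, w) ∈ D1.arcs ∧
  (v, a2) ∈ D2.arcs ∧ (a2, u) ∈ D2.arcs ∧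
  (D1.delVert a1).UReach t w ∧
  (D2.delVert a2).UReach u v ∧
  a ∉ (D1.verts.erase a1) ∪ (D2.verts.erase a2) ∧
  D.verts = insert a ((D1.verts.erase a1) ∪ (D2.verts.erase a2)) ∧
  D.arcs = insert (t, u) (insert (v, w)
    (((D1.arcs \ {(t, a1), (a1, w)}) ∪ (D2.arcs \ {(v, a2), (a2, u)})).image
      fun x => renArc a2 a (renArc a1 a x)))

def IsHajosBijoin (D D1 D2 : Dgraph) : Prop :=
  ∃ t a1 w v a2 u a, IsHajosBijoinAt D D1 D2 t a1 w v a2 u a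

/-! ### Trees, Euler tours and Hajós tree joins -/

/-- Vertex set of the tree given by edges `e : Fin n → ℕ × ℕ`. -/
def treeVerts (n : ℕ) (e : Fin n → ℕ × ℕ) : Finset ℕ :=
  Finset.univ.image (fun i => (e i).1) ∪ Finset.univ.image (fun i => (e i).2)

/-- The bidirected digraph `↔T` of the tree. -/
def treeDigraph (n : ℕ) (e : Fin n → ℕ × ℕ) : Dgraph where
  verts := treeVerts n e
  arcs := Finset.univ.image (fun i : Fin n => e i) ∪
    Finset.univ.image (fun i : Fin n => (e i).swap)

/-- `e` lists the edges of a tree: loopless, pairwise distinct edges,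
connected, with `n + 1` vertices for `n` edges. -/
def IsTree (n : ℕ) (e : Fin n → ℕ × ℕ) : Prop :=
  (∀ i, (e i).1 ≠ (e i).2) ∧
  (∀ i j, i ≠ j → e i ≠ e j ∧ e i ≠ (e j).swap) ∧
  (treeDigraph n e).UConnected ∧
  (treeVerts n e).card = n + 1

/-- The leaves of the tree: vertices incident to exactly one edge. -/
def leafSet (n : ℕ) (e : Fin n → ℕ × ℕ) : Finset ℕ :=
  (treeVerts n e).filter fun x =>
    (Finset.univ.filter fun i : Fin n => (e i).1 = x ∨ (e i).2 = x).card = 1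

/-- `L` is an Eulerian list of the tree: the cyclic sequence of consecutive
pairs of `L` traverses each arc of `↔T` exactly once. -/
def IsEulerTour (n : ℕ) (e : Fin n → ℕ × ℕ) (L : List ℕ) : Prop :=
  ((L.zip (L.rotate 1) : List (ℕ × ℕ)) : Multiset (ℕ × ℕ)) = (treeDigraph n e).arcs.val

/-- `C` is a partial Eulerian list: a circular sublist of an Eulerian list
containing every leaf, in which every non-leaf vertex appears at most once. -/
def IsPartialEulerList (n : ℕ) (e : Fin n → ℕ × ℕ) (C : List ℕ) : Prop :=
  ∃ L m, IsEulerTour n e L ∧ List.Sublist C (L.rotate m) ∧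
    (∀ x ∈ leafSet n e, x ∈ C) ∧
    ∀ x ∈ C, x ∉ leafSet n e → C.count x ≤ 1

/-- Compatibility of the data of a (extended) Hajós tree join:
a tree with edges `uᵢvᵢ = e i`, digraphs `Ds i` with
`V(Ds i) ∩ V(T) = {uᵢ, vᵢ}`, `[uᵢ,vᵢ] ⊆ A(Ds i)` and whose remaining
vertex sets are pairwise disjoint. -/
def JoinCompat (n : ℕ) (e : Fin n → ℕ × ℕ) (Ds : Fin n → Dgraph) : Prop :=
  IsTree n e ∧ (∀ i, (Ds i).WF) ∧
  (∀ i, (Ds i).verts ∩ treeVerts n e = {(e i).1, (e i).2}) ∧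
  (∀ i, e i ∈ (Ds i).arcs ∧ (e i).swap ∈ (Ds i).arcs) ∧
  (∀ i j, i ≠ j →
    Disjoint ((Ds i).verts \ {(e i).1, (e i).2}) ((Ds j).verts \ {(e j).1, (e j).2}))

/-- The digraph obtained from the digraphs `Ds i − [uᵢ,vᵢ]` by adding the
directed cycle through the list `C`. -/
def joinOf (n : ℕ) (e : Fin n → ℕ × ℕ) (Ds : Fin n → Dgraph) (C : List ℕ) : Dgraph where
  verts := Finset.univ.biUnion fun i => (Ds i).verts
  arcs := (Finset.univ.biUnion fun i => (Ds i).arcs \ {e i, (e i).swap}) ∪ cycArcs C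

/-- `D` is the Hajós tree join `T(D₁, …, Dₙ; C)`: the peripheral cycle runs
through the leaves of `T` in the circular order given by a plane embedding
of `T` (equivalently, the order of the leaves along an Euler tour of `↔T`). -/
def IsHajosTreeJoin (D : Dgraph) (n : ℕ) (e : Fin n → ℕ × ℕ)
    (Ds : Fin n → Dgraph) : Prop :=
  JoinCompat n e Ds ∧ ∃ L, IsEulerTour n e L ∧
    D = joinOf n e Ds (L.filter fun x => decide (x ∈ leafSet n e))

/-- `D` is an extended Hajós tree join: the peripheral cycle runs through a
partial Eulerian list of `T`. -/
def IsExtHajosTreeJoin (D : Dgraph) (n : ℕ) (e : Fin n → ℕ × ℕ)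
    (Ds : Fin n → Dgraph) : Prop :=
  JoinCompat n e Ds ∧ ∃ C, IsPartialEulerList n e C ∧ D = joinOf n e Ds C

/-- Hajós star join: a Hajós tree join whose tree is a star. -/
def IsHajosStarJoin (D : Dgraph) (n : ℕ) (e : Fin n → ℕ × ℕ)
    (Ds : Fin n → Dgraph) : Prop :=
  IsHajosTreeJoin D n e Ds ∧ ∃ c, ∀ i, (e i).1 = c ∨ (e i).2 = c

/-- The class `H⃗_k`: for `k = 3` the smallest class containing the symmetric
odd wheels and closed under directed Hajós joins and Hajós tree joins; for
`k ≥ 4` the smallest class containing `↔K_{k+1}` and closed under directed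
Hajós joins and Hajós tree joins. -/
inductive HClass (k : ℕ) : Dgraph → Prop
  | wheel (D : Dgraph) (hk : k = 3) (h : IsSymOddWheel D) : HClass k D
  | complete (D : Dgraph) (hk : 4 ≤ k) (h : IsBiComplete D (k + 1)) : HClass k D
  | dirJoin (D D1 D2 : Dgraph) (h1 : HClass k D1) (h2 : HClass k D2)
      (h : IsDirHajosJoin D D1 D2) : HClass k D
  | treeJoin (D : Dgraph) (n : ℕ) (e : Fin n → ℕ × ℕ) (Ds : Fin n → Dgraph)
      (h : ∀ i, HClass k (Ds i)) (hj : IsHajosTreeJoin D n e Ds) : HClass k D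

/-- The class `EH⃗T_k`: for `k = 3` the smallest class containing the
symmetric odd wheels and closed under extended Hajós tree joins; for `k ≥ 4`
the smallest class containing `↔K_{k+1}` and closed under extended Hajós
tree joins. -/
inductive EHTClass (k : ℕ) : Dgraph → Prop
  | wheel (D : Dgraph) (hk : k = 3) (h : IsSymOddWheel D) : EHTClass k D
  | complete (D : Dgraph) (hk : 4 ≤ k) (h : IsBiComplete D (k + 1)) : EHTClass k D
  | extJoin (D : Dgraph) (n : ℕ) (e : Fin n → ℕ × ℕ) (Ds : Fin n → Dgraph)
      (h : ∀ i, EHTClass k (Ds i)) (hj : IsExtHajosTreeJoin D n e Ds) : EHTClass k D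

/-- Parallel Hajós join of `D_AC` and `D_B` with respect to
`(t, u, v, w, [a,b])`. -/
def IsParallelHajosJoinAt (D DAC DB : Dgraph) (A C : Finset ℕ)
    (x t u v w a b : ℕ) : Prop :=
  DAC.WF ∧ DB.WF ∧
  (a, b) ∈ DB.arcs ∧ (b, a) ∈ DB.arcs ∧
  DAC.verts = A ∪ C ∧ A ∩ C = {x} ∧
  t ∈ A.erase x ∧ w ∈ A.erase x ∧ u ∈ C.erase x ∧ v ∈ C.erase x ∧
  (t, u) ∈ DAC.arcs ∧ (v, w) ∈ DAC.arcs ∧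
  (DAC.delVert x).UReach t w ∧
  ((DAC.induce C).delVert x).UReach u v ∧
  Disjoint DAC.verts DB.verts ∧
  D.verts = DB.verts ∪ (A.erase x) ∪ (C.erase x) ∧
  D.arcs = insert (t, u) (insert (v, w)
    ((DB.arcs \ {(a, b), (b, a)}) ∪
      ((DAC.induce A).arcs.image (renArc x a)) ∪
      ((DAC.induce C).arcs.image (renArc x b))))

def IsParallelHajosJoin (D DAC DB : Dgraph) : Prop :=
  ∃ A C x t u v w a b, IsParallelHajosJoinAt D DAC DB A C x t u v w a b

/-- `S` is (the vertex set of) a strong component of `D`. -/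
def IsStrongComponent (D : Dgraph) (S : Finset ℕ) : Prop :=
  S ⊆ D.verts ∧ S.Nonempty ∧ (D.induce S).Strong ∧
  ∀ S', S ⊆ S' → S' ⊆ D.verts → (D.induce S').Strong → S' = S

/-- `B` is (the vertex set of) a block of `D`: a maximal set inducing a
biconnected subdigraph. -/
def IsBlock (D : Dgraph) (B : Finset ℕ) : Prop :=
  B ⊆ D.verts ∧ (D.induce B).Biconnected ∧
  ∀ B', B ⊆ B' → B' ⊆ D.verts → (D.induce B').Biconnected → B' = B

end Dgraph

open Dgraph

open Dgraph

namespace HJ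

open Relation

/-- Arc relation. -/
def Ar (A : Finset (ℕ × ℕ)) (a b : ℕ) : Prop := (a, b) ∈ A

/-- Arcs of `A` leaving `X`. -/
def cut (A : Finset (ℕ × ℕ)) (X : Finset ℕ) : Finset (ℕ × ℕ) :=
  A.filter fun a => a.1 ∈ X ∧ a.2 ∉ X

lemma mem_cut {A : Finset (ℕ × ℕ)} {X : Finset ℕ} {a : ℕ × ℕ} :
    a ∈ cut A X ↔ a ∈ A ∧ a.1 ∈ X ∧ a.2 ∉ X := by
  simp [cut]

lemma exists_nodup {R : ℕ → ℕ → Prop} {x y : ℕ} (h : ReflTransGen R x y) :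
    ∃ p : List ℕ, (x :: p).Nodup ∧ (x :: p).IsChain R ∧ (x :: p).getLast? = some y := by
  induction h using ReflTransGen.head_induction_on with
  | refl => exact ⟨[], by simp, by simp, by simp⟩
  | @head a c hac _ ih =>
    obtain ⟨p, h1, h2, h3⟩ := ih
    by_cases ha : a ∈ c :: p
    · obtain ⟨s, t, hst⟩ := List.append_of_mem ha
      rw [hst] at h1 h2 h3
      refine ⟨t, (List.nodup_append.1 h1).2.1, (List.isChain_append.1 h2).2.1, ?_⟩
      rw [List.getLast?_append] at h3
      simpa [List.getLast?_cons] using h3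
    · exact ⟨c :: p, List.nodup_cons.2 ⟨ha, h1⟩, List.isChain_cons_cons.2 ⟨hac, h2⟩, by
        simpa [List.getLast?_cons] using h3⟩

lemma chain_reach {R : ℕ → ℕ → Prop} {y : ℕ} (p : List ℕ) :
    ∀ x, (x :: p).IsChain R → (x :: p).getLast? = some y → ReflTransGen R x y := by
  induction p with
  | nil => intro x _ h; simp at h; rw [h]
  | cons b p ih =>
    intro x h1 h2
    rw [List.isChain_cons_cons] at h1
    exact ReflTransGen.head h1.1 (ih b h1.2 (by simpa [List.getLast?_cons] using h2))

/-- A walk leaving `X` crosses the boundary. -/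
lemma reach_cross {R : ℕ → ℕ → Prop} {x y : ℕ} (h : ReflTransGen R x y) (P : ℕ → Prop)
    (hx : P x) (hy : ¬ P y) : ∃ a b, R a b ∧ P a ∧ ¬ P b := by
  by_contra hc
  push Not at hc
  apply hy
  clear hy
  induction h with
  | refl => exact hx
  | tail _ h2 ih => exact hc _ _ h2 ih

/-- Net out-flow at a vertex. -/
def ex (F : Finset (ℕ × ℕ)) (z : ℕ) : ℤ :=
  ∑ a ∈ F, ((if a.1 = z then 1 else 0) - (if a.2 = z then 1 else 0))

/-- Kronecker delta. -/
def dl (x z : ℕ) : ℤ := if x = z then 1 else 0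

lemma ex_insert {F : Finset (ℕ × ℕ)} {a b : ℕ} (h : (a, b) ∉ F) (z : ℕ) :
    ex (insert (a, b) F) z = ex F z + dl a z - dl b z := by
  unfold ex dl
  rw [Finset.sum_insert h]; ring

lemma ex_erase {F : Finset (ℕ × ℕ)} {a b : ℕ} (h : (a, b) ∈ F) (z : ℕ) :
    ex (F.erase (a, b)) z = ex F z - dl a z + dl b z := by
  have := ex_insert (Finset.notMem_erase (a, b) F) z
  rw [Finset.insert_erase h] at this
  linarith

lemma ex_sdiff {F G : Finset (ℕ × ℕ)} (h : G ⊆ F) (z : ℕ) :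
    ex (F \ G) z = ex F z - ex G z := by
  unfold ex
  rw [← Finset.sum_sdiff h]; ring

lemma sum_ex (F : Finset (ℕ × ℕ)) (X : Finset ℕ) :
    ∑ z ∈ X, ex F z = ∑ a ∈ F, ((if a.1 ∈ X then 1 else 0) - (if a.2 ∈ X then 1 else 0)) := by
  unfold ex
  rw [Finset.sum_comm]
  apply Finset.sum_congr rfl
  intro a _
  rw [Finset.sum_sub_distrib, Finset.sum_ite_eq, Finset.sum_ite_eq]

lemma sum_dl (x y : ℕ) (j : ℤ) (X : Finset ℕ) (hx : x ∈ X) (hy : y ∉ X) :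
    ∑ z ∈ X, j * (dl x z - dl y z) = j := by
  unfold dl
  rw [← Finset.mul_sum, Finset.sum_sub_distrib, Finset.sum_ite_eq, Finset.sum_ite_eq]
  simp [hx, hy]

/-- Residual relation. -/
def Res (A F : Finset (ℕ × ℕ)) (a b : ℕ) : Prop :=
  ((a, b) ∈ A ∧ (a, b) ∉ F) ∨ (b, a) ∈ F

lemma augment {A F : Finset (ℕ × ℕ)} (hF : F ⊆ A) {y : ℕ} (p : List ℕ) :
    ∀ x, (x :: p).Nodup → (x :: p).IsChain (Res A F) → (x :: p).getLast? = some y →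
      ∃ F' ⊆ A, (∀ z, ex F' z = ex F z + dl x z - dl y z) ∧
        ∀ a : ℕ × ℕ, (a.1 ∉ x :: p ∨ a.2 ∉ x :: p) → (a ∈ F' ↔ a ∈ F) := by
  induction p with
  | nil =>
    intro x _ _ h
    simp at h
    subst h
    exact ⟨F, hF, by intro z; ring, by simp⟩
  | cons b p ih =>
    intro x h1 h2 h3
    rw [List.isChain_cons_cons] at h2
    rw [List.nodup_cons] at h1
    obtain ⟨F', hA, he, hm⟩ := ih b h1.2 h2.2 (by simpa [List.getLast?_cons] using h3)
    rcases h2.1 with ⟨h4, h5⟩ | h4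
    · have h6 : (x, b) ∉ F' := by rw [hm _ (Or.inl h1.1)]; exact h5
      refine ⟨insert (x, b) F', Finset.insert_subset h4 hA, ?_, ?_⟩
      · intro z; rw [ex_insert h6, he]; ring
      · rintro ⟨c, d⟩ hcd
        have : (c, d) ≠ (x, b) := by
          rintro h; simp at h; obtain ⟨rfl, rfl⟩ := h; simp at hcd
        rw [Finset.mem_insert, or_iff_right this]
        apply hm
        simp only [List.mem_cons, not_or] at hcd ⊢
        tauto
    · have h6 : (b, x) ∈ F' := by rw [hm _ (Or.inr h1.1)]; exact h4
      refine ⟨F'.erase (b, x), (Finset.erase_subset _ _).trans hA, ?_, ?_⟩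
      · intro z; rw [ex_erase h6, he]; ring
      · rintro ⟨c, d⟩ hcd
        have : (c, d) ≠ (b, x) := by
          rintro h; simp at h; obtain ⟨rfl, rfl⟩ := h; simp at hcd
        rw [Finset.mem_erase, and_iff_right this]
        apply hm
        simp only [List.mem_cons, not_or] at hcd ⊢
        tauto

lemma exists_flow {V : Finset ℕ} {A : Finset (ℕ × ℕ)} (hV : ∀ a ∈ A, a.1 ∈ V ∧ a.2 ∈ V)
    {x y : ℕ} (hx : x ∈ V) (n : ℕ)
    (hc : ∀ X : Finset ℕ, x ∈ X → y ∉ X → n ≤ (cut A X).card) :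
    ∀ j ≤ n, ∃ F ⊆ A, ∀ z, ex F z = (j : ℤ) * (dl x z - dl y z) := by
  classical
  intro j
  induction j with
  | zero => intro _; exact ⟨∅, by simp, by intro z; simp [ex]⟩
  | succ j ih =>
    intro hj
    obtain ⟨F, hF, he⟩ := ih (by omega)
    by_cases hr : ReflTransGen (Res A F) x y
    · obtain ⟨p, h1, h2, h3⟩ := exists_nodup hr
      obtain ⟨F', hA, he', _⟩ := augment hF p x h1 h2 h3
      exact ⟨F', hA, by intro z; rw [he', he]; push_cast; ring⟩
    · exfalso
      set X := V.filter (fun z => ReflTransGen (Res A F) x z) with hX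
      have hxX : x ∈ X := by simp [hX, hx, ReflTransGen.refl]
      have hyX : y ∉ X := by simp [hX, hr]
      have h1 := hc X hxX hyX
      have h2 : ∑ z ∈ X, ex F z = j := by
        rw [Finset.sum_congr rfl (fun z _ => he z)]
        exact sum_dl x y j X hxX hyX
      rw [sum_ex] at h2
      have h3 : cut A X = F.filter (fun a => a.1 ∈ X ∧ a.2 ∉ X) := by
        ext ⟨a, b⟩
        simp only [mem_cut, Finset.mem_filter]
        constructor
        · rintro ⟨hA, ha, hb⟩
          refine ⟨?_, ha, hb⟩
          by_contra hn
          apply hb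
          rw [hX, Finset.mem_filter] at ha ⊢
          exact ⟨(hV _ hA).2, ha.2.tail (Or.inl ⟨hA, hn⟩)⟩
        · rintro ⟨hA, ha, hb⟩
          exact ⟨hF hA, ha, hb⟩
      have h4 : ∑ a ∈ F, (((if a.1 ∈ X then 1 else 0) - (if a.2 ∈ X then 1 else 0)) : ℤ)
          = (cut A X).card := by
        rw [h3, Finset.card_filter]
        push_cast
        apply Finset.sum_congr rfl
        rintro ⟨a, b⟩ hab
        have : b ∈ X → a ∈ X := by
          intro hb
          rw [hX, Finset.mem_filter] at hb ⊢
          exact ⟨(hV _ (hF hab)).1, hb.2.tail (Or.inr hab)⟩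
        by_cases hb : b ∈ X
        · simp [hb, this hb]
        · by_cases ha : a ∈ X <;> simp [ha, hb]
      rw [h4] at h2
      have : (cut A X).card = j := by exact_mod_cast h2
      omega

lemma arcsOf_cons (a b : ℕ) (p : List ℕ) :
    Dgraph.arcsOf (a :: b :: p) = insert (a, b) (Dgraph.arcsOf (b :: p)) := by
  simp [Dgraph.arcsOf]

lemma arcsOf_mem (p : List ℕ) : ∀ x, ∀ a ∈ Dgraph.arcsOf (x :: p), a.1 ∈ x :: p ∧ a.2 ∈ x :: p := by
  induction p with
  | nil => intro x a h; simp [Dgraph.arcsOf] at h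
  | cons b p ih =>
    intro x a h
    rw [arcsOf_cons, Finset.mem_insert] at h
    rcases h with rfl | h
    · simp
    · have := ih b a h
      exact ⟨List.mem_cons_of_mem _ this.1, List.mem_cons_of_mem _ this.2⟩

lemma arcsOf_sub {F : Finset (ℕ × ℕ)} (p : List ℕ) :
    ∀ x, (x :: p).IsChain (Ar F) → Dgraph.arcsOf (x :: p) ⊆ F := by
  induction p with
  | nil => intro x _; simp [Dgraph.arcsOf]
  | cons b p ih =>
    intro x h
    rw [List.isChain_cons_cons] at h
    rw [arcsOf_cons]
    exact Finset.insert_subset h.1 (ih b h.2)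

lemma arcsOf_ex {y : ℕ} (p : List ℕ) :
    ∀ x, (x :: p).Nodup → (x :: p).getLast? = some y →
      ∀ z, ex (Dgraph.arcsOf (x :: p)) z = dl x z - dl y z := by
  induction p with
  | nil => intro x _ h z; simp at h; subst h; simp [Dgraph.arcsOf, ex]
  | cons b p ih =>
    intro x h1 h2 z
    rw [List.nodup_cons] at h1
    rw [arcsOf_cons, ex_insert, ih b h1.2 (by simpa [List.getLast?_cons] using h2)]
    · ring
    · intro h
      exact h1.1 (arcsOf_mem p b _ h).1

lemma decompose {V : Finset ℕ} {x y : ℕ} (hx : x ∈ V) (j : ℕ) : ∀ F : Finset (ℕ × ℕ),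
    (∀ a ∈ F, a.1 ∈ V ∧ a.2 ∈ V) → (∀ z, ex F z = (j : ℤ) * (dl x z - dl y z)) →
    ∃ P : Fin j → List ℕ, (∀ i, (x :: P i).Nodup ∧ (x :: P i).IsChain (Ar F) ∧
      (x :: P i).getLast? = some y) ∧
      Pairwise fun i i' => Disjoint (Dgraph.arcsOf (x :: P i)) (Dgraph.arcsOf (x :: P i')) := by
  classical
  induction j with
  | zero => intro F _ _; exact ⟨fun i => i.elim0, fun i => i.elim0, fun i => i.elim0⟩
  | succ j ih =>
    intro F hV he
    have hr : ReflTransGen (Ar F) x y := by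
      by_contra hr
      set X := V.filter (fun z => ReflTransGen (Ar F) x z) with hX
      have hxX : x ∈ X := by simp [hX, hx, ReflTransGen.refl]
      have hyX : y ∉ X := by simp [hX, hr]
      have h2 : ∑ z ∈ X, ex F z = ((j + 1 : ℕ) : ℤ) := by
        rw [Finset.sum_congr rfl (fun z _ => he z)]
        exact sum_dl x y _ X hxX hyX
      rw [sum_ex] at h2
      have h3 : ∑ a ∈ F, (((if a.1 ∈ X then 1 else 0) - (if a.2 ∈ X then 1 else 0)) : ℤ) ≤ 0 := by
        apply Finset.sum_nonpos
        rintro ⟨a, b⟩ hab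
        have : a ∈ X → b ∈ X := by
          intro hb
          rw [hX, Finset.mem_filter] at hb ⊢
          exact ⟨(hV _ hab).2, hb.2.tail hab⟩
        by_cases ha : a ∈ X
        · simp [ha, this ha]
        · by_cases hb : b ∈ X <;> simp [ha, hb]
      rw [h2] at h3
      push_cast at h3
      linarith
    obtain ⟨p, h1, h2, h3⟩ := exists_nodup hr
    have hsub := arcsOf_sub p x h2
    obtain ⟨P, hP, hd⟩ := ih (F \ Dgraph.arcsOf (x :: p))
      (fun a ha => hV a (Finset.mem_sdiff.1 ha).1) (by
        intro z
        rw [ex_sdiff hsub, he, arcsOf_ex p x h1 h3]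
        push_cast; ring)
    have hdis : ∀ i, Disjoint (Dgraph.arcsOf (x :: p)) (Dgraph.arcsOf (x :: P i)) := by
      intro i
      exact Finset.disjoint_of_subset_right (arcsOf_sub (P i) x (hP i).2.1) Finset.disjoint_sdiff
    refine ⟨Fin.cons p P, ?_, ?_⟩
    · intro i
      refine Fin.cases ?_ ?_ i
      · exact ⟨h1, h2, h3⟩
      · intro i
        refine ⟨(hP i).1, (hP i).2.1.imp ?_, (hP i).2.2⟩
        intro a b h
        exact (Finset.mem_sdiff.1 h).1
    · intro i i'
      refine Fin.cases ?_ ?_ i <;> refine Fin.cases ?_ ?_ i'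
      · intro h; exact absurd rfl h
      · intro i' _; exact hdis i'
      · intro i _; exact (hdis i).symm
      · intro i' i h
        exact hd (fun hh => h (congrArg Fin.succ hh))

lemma chain_verts {V : Finset ℕ} {A : Finset (ℕ × ℕ)} (hV : ∀ a ∈ A, a.1 ∈ V ∧ a.2 ∈ V)
    (p : List ℕ) : ∀ x ∈ V, (x :: p).IsChain (Ar A) → ∀ z ∈ x :: p, z ∈ V := by
  induction p with
  | nil => intro x hx _ z hz; simp at hz; rw [hz]; exact hx
  | cons b p ih =>
    intro x hx h z hz
    rw [List.isChain_cons_cons] at h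
    rcases List.mem_cons.1 hz with rfl | hz
    · exact hx
    · exact ih b (hV _ h.1).2 h.2 z hz

lemma chain_cross {A : Finset (ℕ × ℕ)} {X : Finset ℕ} {y : ℕ} (hy : y ∉ X) (p : List ℕ) :
    ∀ x ∈ X, (x :: p).IsChain (Ar A) → (x :: p).getLast? = some y →
      ∃ a ∈ Dgraph.arcsOf (x :: p), a ∈ cut A X := by
  induction p with
  | nil => intro x hx _ h; simp at h; subst h; exact absurd hx hy
  | cons b p ih =>
    intro x hx h h2
    rw [List.isChain_cons_cons] at h
    by_cases hb : b ∈ X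
    · obtain ⟨a, h3, h4⟩ := ih b hb h.2 (by simpa [List.getLast?_cons] using h2)
      exact ⟨a, by rw [arcsOf_cons]; exact Finset.mem_insert_of_mem h3, h4⟩
    · exact ⟨(x, b), by rw [arcsOf_cons]; exact Finset.mem_insert_self _ _,
        mem_cut.2 ⟨h.1, hx, hb⟩⟩

lemma dipath_cons {D : Dgraph} {p : List ℕ} {x y : ℕ} (h : D.IsDipath p x y) :
    ∃ q, p = x :: q ∧ (x :: q).Nodup ∧ (x :: q).IsChain (Ar D.arcs) ∧
      (x :: q).getLast? = some y := by
  obtain ⟨h1, h2, h3, _, h5⟩ := h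
  cases p with
  | nil => simp at h2
  | cons a q =>
    simp at h2; subst h2
    exact ⟨q, rfl, h1, h5, h3⟩

lemma family_le {D : Dgraph} {x y n : ℕ} (P : Fin n → List ℕ)
    (h1 : ∀ i, D.IsDipath (P i) x y)
    (h2 : Pairwise fun i j => Disjoint (Dgraph.arcsOf (P i)) (Dgraph.arcsOf (P j)))
    (X : Finset ℕ) (hx : x ∈ X) (hy : y ∉ X) : n ≤ (cut D.arcs X).card := by
  have : ∀ i, ∃ a ∈ Dgraph.arcsOf (P i), a ∈ cut D.arcs X := by
    intro i
    obtain ⟨q, hq, _, h4, h5⟩ := dipath_cons (h1 i)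
    rw [hq]
    exact chain_cross hy q x hx h4 h5
  choose f hf1 hf2 using this
  have := Finset.card_le_card_of_injOn (s := (Finset.univ : Finset (Fin n))) (t := cut D.arcs X) f
    (fun i _ => hf2 i) (by
      intro i _ j _ hij
      by_contra hne
      exact Finset.disjoint_left.1 (h2 hne) (hf1 i) (by rw [hij]; exact hf1 j))
  simpa using this

/-- Arc version of the Menger theorem. -/
lemma le_locLam_iff {D : Dgraph} (hD : D.WF) {x y : ℕ} (hx : x ∈ D.verts) (hxy : x ≠ y) (n : ℕ) :
    n ≤ D.locLam x y ↔ ∀ X : Finset ℕ, x ∈ X → y ∉ X → n ≤ (cut D.arcs X).card := by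
  have hbdd : BddAbove {n | ∃ P : Fin n → List ℕ, (∀ i, D.IsDipath (P i) x y) ∧
    Pairwise fun i j => Disjoint (Dgraph.arcsOf (P i)) (Dgraph.arcsOf (P j))} := by
    refine ⟨(cut D.arcs {x}).card, ?_⟩
    rintro m ⟨P, h1, h2⟩
    exact family_le P h1 h2 {x} (by simp) (by simpa using hxy.symm)
  have hV : ∀ a ∈ D.arcs, a.1 ∈ D.verts ∧ a.2 ∈ D.verts := fun a ha => ⟨(hD a ha).1, (hD a ha).2.1⟩
  constructor
  · intro hn X hxX hyX
    have hmem := Nat.sSup_mem (s := {n | ∃ P : Fin n → List ℕ, (∀ i, D.IsDipath (P i) x y) ∧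
      Pairwise fun i j => Disjoint (Dgraph.arcsOf (P i)) (Dgraph.arcsOf (P j))})
      ⟨0, fun i => i.elim0, fun i => i.elim0, fun i => i.elim0⟩ hbdd
    obtain ⟨P, h1, h2⟩ := hmem
    exact hn.trans (family_le P h1 h2 X hxX hyX)
  · intro hc
    apply le_csSup hbdd
    obtain ⟨F, hF, he⟩ := exists_flow hV hx n hc n le_rfl
    obtain ⟨P, hP, hd⟩ := decompose hx n F (fun a ha => hV a (hF ha)) he
    refine ⟨fun i => x :: P i, fun i => ?_, hd⟩
    have hch : (x :: P i).IsChain (Ar D.arcs) := (hP i).2.1.imp (fun a b h => hF h)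
    exact ⟨(hP i).1, rfl, (hP i).2.2, chain_verts hV _ x hx hch, hch⟩

lemma strong_iff {D : Dgraph} (hD : D.WF) : D.Strong ↔
    ∀ x ∈ D.verts, ∀ y ∈ D.verts, ReflTransGen (Ar D.arcs) x y := by
  have hV : ∀ a ∈ D.arcs, a.1 ∈ D.verts ∧ a.2 ∈ D.verts := fun a ha => ⟨(hD a ha).1, (hD a ha).2.1⟩
  constructor
  · intro h x hx y hy
    by_cases hxy : x = y
    · rw [hxy]
    · obtain ⟨p, hp⟩ := h x hx y hy hxy
      obtain ⟨q, _, _, h4, h5⟩ := dipath_cons hp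
      exact chain_reach q x h4 h5
  · intro h x hx y hy _
    obtain ⟨p, h1, h2, h3⟩ := exists_nodup (h x hx y hy)
    exact ⟨x :: p, h1, rfl, h3, chain_verts hV _ x hx h2, h2⟩

end HJ
namespace HJ

open Relation

/-- `A` is `k`-dicolourable: colour classes have acyclic rankings. -/
def Col (A : Finset (ℕ × ℕ)) (k : ℕ) : Prop :=
  ∃ φ : ℕ → Fin k, ∃ f : ℕ → ℤ, ∀ a ∈ A, φ a.1 = φ a.2 → f a.1 < f a.2

lemma chain_rank {R : ℕ → ℕ → Prop} {f : ℕ → ℤ} (hR : ∀ a b, R a b → f a < f b) {x y : ℕ}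
    (h : ReflTransGen R x y) : f x ≤ f y := by
  induction h with
  | refl => exact le_rfl
  | tail _ h2 ih => exact ih.trans (hR _ _ h2).le

lemma chain_mono {R : ℕ → ℕ → Prop} {k : ℕ} {φ : ℕ → Fin k} {c : Fin k} (p : List ℕ) :
    ∀ x, (x :: p).IsChain R → (∀ z ∈ x :: p, φ z = c) →
      (x :: p).IsChain (fun a b => R a b ∧ φ a = φ b) := by
  induction p with
  | nil => intro x _ _; simp
  | cons b p ih =>
    intro x h hc
    rw [List.isChain_cons_cons] at h ⊢
    refine ⟨⟨h.1, ?_⟩, ih b h.2 (fun z hz => hc z (List.mem_cons_of_mem _ hz))⟩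
    rw [hc x (by simp), hc b (by simp)]

lemma chain_unmono {R : ℕ → ℕ → Prop} {k : ℕ} {φ : ℕ → Fin k} (p : List ℕ) :
    ∀ x, (x :: p).IsChain (fun a b => R a b ∧ φ a = φ b) → ∀ z ∈ x :: p, φ z = φ x := by
  induction p with
  | nil => intro x _ z hz; simp at hz; rw [hz]
  | cons b p ih =>
    intro x h z hz
    rw [List.isChain_cons_cons] at h
    rcases List.mem_cons.1 hz with rfl | hz
    · rfl
    · rw [ih b h.2 z hz, h.1.2]

lemma dicol_iff {D : Dgraph} (hD : D.WF) (k : ℕ) :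
    (∃ φ : ℕ → Fin k, D.IsDicolouring k φ) ↔ Col D.arcs k := by
  classical
  have hV : ∀ a ∈ D.arcs, a.1 ∈ D.verts ∧ a.2 ∈ D.verts := fun a ha => ⟨(hD a ha).1, (hD a ha).2.1⟩
  constructor
  · rintro ⟨φ, hφ⟩
    set R : ℕ → ℕ → Prop := fun a b => Ar D.arcs a b ∧ φ a = φ b with hR
    have hac : ∀ x, ¬ TransGen R x x := by
      intro x hx
      obtain ⟨y, hxy, hyx⟩ := TransGen.head'_iff.1 hx
      obtain ⟨p, h1, h2, h3⟩ := exists_nodup hyx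
      have hch : (y :: p).IsChain (Ar D.arcs) := h2.imp (fun a b h => h.1)
      apply hφ (y :: p)
      · refine ⟨?_, h1, chain_verts hV p y (hV _ hxy.1).2 hch, hch, ?_⟩
        · cases p with
          | nil =>
            simp at h3
            exact absurd h3.symm (hD _ hxy.1).2.2
          | cons b p => simp
        · intro a b ha hb
          rw [h3] at ha
          simp at ha hb
          subst ha; subst hb
          exact hxy.1
      · exact ⟨φ y, chain_unmono p y h2⟩
    refine ⟨φ, fun x => ((D.verts.filter fun z => TransGen R z x).card : ℤ), ?_⟩
    rintro ⟨a, b⟩ hab hc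
    simp only at hc ⊢
    have hRab : R a b := ⟨hab, hc⟩
    rw [Nat.cast_lt]
    apply Finset.card_lt_card
    rw [Finset.ssubset_iff_of_subset]
    · refine ⟨a, ?_, ?_⟩
      · simp [(hV _ hab).1, TransGen.single hRab]
      · simp [hac a]
    · intro z hz
      rw [Finset.mem_filter] at hz ⊢
      exact ⟨hz.1, hz.2.tail hRab⟩
  · rintro ⟨φ, f, hf⟩
    refine ⟨φ, ?_⟩
    rintro p ⟨h1, h2, h3, h4, h5⟩ ⟨c, hc⟩
    cases p with
    | nil => simp at h1
    | cons x p =>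
      obtain ⟨y, hy⟩ : ∃ y, (x :: p).getLast? = some y := by
        rw [List.getLast?_cons]; exact ⟨_, rfl⟩
      have hy' : y ∈ x :: p := List.mem_of_getLast? hy
      have hr := chain_reach p x (chain_mono p x h4 hc) hy
      have h6 := chain_rank (f := f) (fun a b h => hf (a, b) h.1 h.2) hr
      have h7 := hf _ (h5 y x hy rfl) (by rw [hc y hy', hc x (by simp)])
      simp only at h7
      omega

lemma Col.mono {A B : Finset (ℕ × ℕ)} {k : ℕ} (h : Col A k) (hBA : B ⊆ A) : Col B k := by
  obtain ⟨φ, f, hf⟩ := h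
  exact ⟨φ, f, fun a ha => hf a (hBA ha)⟩

lemma Col.le {A : Finset (ℕ × ℕ)} {k l : ℕ} (h : Col A k) (hkl : k ≤ l) : Col A l := by
  obtain ⟨φ, f, hf⟩ := h
  refine ⟨fun x => Fin.castLE hkl (φ x), f, fun a ha h => hf a ha ?_⟩
  simpa using h

lemma Col.succ_of_erase {A : Finset (ℕ × ℕ)} {k p q : ℕ} (hpq : p ≠ q)
    (h : Col (A.erase (p, q)) k) : Col A (k + 1) := by
  obtain ⟨φ, f, hf⟩ := h
  by_cases hl : ∀ a ∈ A, a.1 ≠ a.2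
  · refine ⟨fun x => if x = p then Fin.last k else (φ x).castSucc, f, ?_⟩
    rintro ⟨a, b⟩ hab hc
    have hne := hl _ hab
    simp only at hc hne ⊢
    split_ifs at hc with h1 h2 h2
    · exact absurd (h1.trans h2.symm) hne
    · exact absurd hc.symm (Fin.castSucc_lt_last _).ne
    · exact absurd hc (Fin.castSucc_lt_last _).ne
    · refine hf (a, b) (Finset.mem_erase.2 ⟨?_, hab⟩) (Fin.castSucc_injective _ hc)
      intro h; simp at h; exact h1 h.1
  · push Not at hl
    obtain ⟨a, ha, hne⟩ := hl
    have : a ∈ A.erase (p, q) := Finset.mem_erase.2 ⟨by rintro rfl; exact hpq hne, ha⟩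
    have := hf a this (by rw [hne])
    rw [hne] at this
    exact absurd this (lt_irrefl _)

lemma dichi_iff {D : Dgraph} (hD : D.WF) (k : ℕ) :
    D.dichi = k + 1 ↔ Col D.arcs (k + 1) ∧ ¬ Col D.arcs k := by
  have : D.dichi = sInf {k | Col D.arcs k} := by
    unfold Dgraph.dichi
    congr 1
    ext k
    exact dicol_iff hD k
  rw [this]
  constructor
  · intro h
    have h1 : sInf {k | Col D.arcs k} ∈ {k | Col D.arcs k} :=
      Nat.sInf_mem (Nat.nonempty_of_pos_sInf (by omega))
    refine ⟨by rw [← h]; exact h1, ?_⟩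
    intro hk
    have := Nat.sInf_le (s := {k | Col D.arcs k}) hk
    omega
  · rintro ⟨h1, h2⟩
    apply le_antisymm
    · exact Nat.sInf_le h1
    · by_contra hlt
      push Not at hlt
      have h3 : sInf {k | Col D.arcs k} ∈ {k | Col D.arcs k} := Nat.sInf_mem ⟨_, h1⟩
      exact h2 (Col.le h3 (by omega))

/-- Arcs with both ends in `S`. -/
def sub (A : Finset (ℕ × ℕ)) (S : Finset ℕ) : Finset (ℕ × ℕ) :=
  A.filter fun a => a.1 ∈ S ∧ a.2 ∈ S

lemma mem_sub {A : Finset (ℕ × ℕ)} {S : Finset ℕ} {a : ℕ × ℕ} :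
    a ∈ sub A S ↔ a ∈ A ∧ a.1 ∈ S ∧ a.2 ∈ S := by simp [sub]

/-- Gluing colourings along a small dicut. -/
lemma cut_glue {A : Finset (ℕ × ℕ)} {S X : Finset ℕ} {k : ℕ}
    (h1 : Col (sub A (S ∩ X)) k) (h2 : Col (sub A (S \ X)) k) (hc : (cut (sub A S) X).card < k) :
    Col (sub A S) k := by
  obtain ⟨φ1, f1, hf1⟩ := h1
  obtain ⟨φ2, f2, hf2⟩ := h2
  have : NeZero k := ⟨by omega⟩
  obtain ⟨s, hs⟩ : ∃ s : Fin k, s ∉ (cut (sub A S) X).image (fun a => φ2 a.2 - φ1 a.1) := by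
    by_contra hcon
    push Not at hcon
    have h3 : (Finset.univ : Finset (Fin k)) ⊆
        (cut (sub A S) X).image (fun a => φ2 a.2 - φ1 a.1) := fun s _ => hcon s
    have h4 := Finset.card_le_card h3
    have h5 := Finset.card_image_le (s := cut (sub A S) X) (f := fun a => φ2 a.2 - φ1 a.1)
    simp at h4
    omega
  obtain ⟨M, hM⟩ : ∃ M : ℤ, ∀ a ∈ A, f2 a.1 < f1 a.2 + M := by
    refine ⟨∑ a ∈ A, |f2 a.1 - f1 a.2| + 1, fun a ha => ?_⟩
    have := Finset.single_le_sum (f := fun a : ℕ × ℕ => |f2 a.1 - f1 a.2|)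
      (fun _ _ => abs_nonneg _) ha
    have h3 := le_abs_self (f2 a.1 - f1 a.2)
    linarith
  refine ⟨fun z => if z ∈ X then φ1 z + s else φ2 z,
    fun z => if z ∈ X then f1 z + M else f2 z, ?_⟩
  rintro ⟨a, b⟩ hab hcol
  have hab' := mem_sub.1 hab
  simp only at hcol hab' ⊢
  by_cases ha : a ∈ X <;> by_cases hb : b ∈ X <;> simp only [ha, hb, if_true, if_false] at hcol ⊢
  · have := hf1 (a, b) (mem_sub.2 ⟨hab'.1, by simp [hab'.2.1, ha], by simp [hab'.2.2, hb]⟩)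
      (add_right_cancel hcol)
    simp only at this
    linarith
  · exfalso
    apply hs
    rw [Finset.mem_image]
    refine ⟨(a, b), mem_cut.2 ⟨hab, ha, hb⟩, ?_⟩
    simp only
    rw [← hcol]
    exact add_sub_cancel_left _ _
  · exact hM (a, b) hab'.1
  · exact hf2 (a, b) (mem_sub.2 ⟨hab'.1, by simp [hab'.2.1, ha], by simp [hab'.2.2, hb]⟩) hcol

/-- Well-formedness. -/
def Wf (V : Finset ℕ) (A : Finset (ℕ × ℕ)) : Prop :=
  ∀ a ∈ A, a.1 ∈ V ∧ a.2 ∈ V ∧ a.1 ≠ a.2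

lemma exists_core {V : Finset ℕ} {A : Finset (ℕ × ℕ)} (hV : Wf V A) {k : ℕ} (hk : 1 ≤ k)
    (h : ¬ Col A k) : ∃ S ⊆ V, (∃ x ∈ S, ∃ y ∈ S, x ≠ y) ∧ ∀ x ∈ S, ∀ y ∈ S,
      ∀ X : Finset ℕ, x ∈ X → y ∉ X → k ≤ (cut (sub A S) X).card := by
  classical
  have hsubV : sub A V = A := by
    ext a
    rw [mem_sub]
    exact ⟨fun h => h.1, fun h => ⟨h, (hV a h).1, (hV a h).2.1⟩⟩
  have hex : ∃ n, ∃ S ⊆ V, S.card = n ∧ ¬ Col (sub A S) k :=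
    ⟨_, V, subset_rfl, rfl, by rw [hsubV]; exact h⟩
  obtain ⟨S, hSV, hSn, hS⟩ := Nat.find_spec hex
  have hmin : ∀ T ⊂ S, Col (sub A T) k := by
    intro T hT
    by_contra hcon
    exact Nat.find_min hex (m := T.card) (by rw [← hSn]; exact Finset.card_lt_card hT)
      ⟨T, hT.1.trans hSV, rfl, hcon⟩
  refine ⟨S, hSV, ?_, ?_⟩
  · by_contra hcon
    push Not at hcon
    apply hS
    refine ⟨fun _ => ⟨0, hk⟩, fun _ => 0, fun a ha => ?_⟩
    rw [mem_sub] at ha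
    exact absurd (hcon _ ha.2.1 _ ha.2.2) (hV a ha.1).2.2
  · intro x hx y hy X hxX hyX
    by_contra hlt
    push Not at hlt
    refine hS (cut_glue (hmin _ ?_) (hmin _ ?_) hlt)
    · rw [Finset.ssubset_iff_of_subset Finset.inter_subset_left]
      exact ⟨y, hy, by simp [hyX]⟩
    · rw [Finset.ssubset_iff_of_subset Finset.sdiff_subset]
      exact ⟨x, hx, by simp [hxX]⟩

/-- Strong. -/
def Str (V : Finset ℕ) (A : Finset (ℕ × ℕ)) : Prop :=
  ∀ x ∈ V, ∀ y ∈ V, ReflTransGen (Ar A) x y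

/-- Adjacency avoiding `c`. -/
def Adv (A : Finset (ℕ × ℕ)) (c a b : ℕ) : Prop := ((a, b) ∈ A ∨ (b, a) ∈ A) ∧ a ≠ c ∧ b ≠ c

/-- No cutvertex. -/
def NoCut (V : Finset ℕ) (A : Finset (ℕ × ℕ)) : Prop :=
  ∀ c ∈ V, ∀ x ∈ V, ∀ y ∈ V, x ≠ c → y ≠ c → ReflTransGen (Adv A c) x y

/-- Local arc-connectivity at most `k`. -/
def Sep (V : Finset ℕ) (A : Finset (ℕ × ℕ)) (k : ℕ) : Prop :=
  ∀ x ∈ V, ∀ y ∈ V, x ≠ y → ∃ X : Finset ℕ, x ∈ X ∧ y ∉ X ∧ (cut A X).card ≤ k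

lemma ear_contra {V : Finset ℕ} {A H : Finset (ℕ × ℕ)} {k : ℕ} (hs : Sep V A k) (hH : H ⊆ A)
    {x y : ℕ} (hx : x ∈ V) (hy : y ∈ V) (hxy : x ≠ y)
    (hc : ∀ X : Finset ℕ, x ∈ X → y ∉ X → k ≤ (cut H X).card)
    (hr : ReflTransGen (Ar (A \ H)) x y) : False := by
  obtain ⟨X, hxX, hyX, hle⟩ := hs x hx y hy hxy
  obtain ⟨a, b, hab, ha, hb⟩ := reach_cross hr (fun z => z ∈ X) hxX hyX
  have hab := Finset.mem_sdiff.1 hab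
  have h1 : insert (a, b) (cut H X) ⊆ cut A X := by
    intro e he
    rcases Finset.mem_insert.1 he with rfl | he
    · exact mem_cut.2 ⟨hab.1, ha, hb⟩
    · rw [mem_cut] at he ⊢
      exact ⟨hH he.1, he.2⟩
  have h2 := Finset.card_le_card h1
  rw [Finset.card_insert_of_notMem (fun h => hab.2 (mem_cut.1 h).1)] at h2
  have := hc X hxX hyX
  omega

/-- Extremal digraphs are arc-critical. -/
lemma critical {V : Finset ℕ} {A : Finset (ℕ × ℕ)} (hV : Wf V A) {k : ℕ} (hk : 1 ≤ k)
    (hstr : Str V A) (hnc : NoCut V A) (hs : Sep V A k) {e : ℕ × ℕ} (he : e ∈ A) :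
    Col (A.erase e) k := by
  by_contra hcol
  obtain ⟨S, hSV, ⟨s, hsS, s', hsS', hss⟩, hcore⟩ :=
    exists_core (fun a ha => hV a (Finset.mem_of_mem_erase ha)) hk hcol
  set H := sub (A.erase e) S with hHdef
  have hHA : H ⊆ A := fun a ha => Finset.mem_of_mem_erase (mem_sub.1 ha).1
  have noreach : ∀ x ∈ S, ∀ y ∈ S, ReflTransGen (Ar (A \ H)) x y → x = y := by
    intro x hx y hy hr
    by_contra hxy
    exact ear_contra hs hHA (hSV hx) (hSV hy) hxy (hcore x hx y hy) hr
  have hB1 : ∀ a b, (a, b) ∈ A → a ∉ S → Ar (A \ H) a b := by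
    intro a b hab ha
    exact Finset.mem_sdiff.2 ⟨hab, fun h => ha (mem_sub.1 h).2.1⟩
  have hB2 : ∀ a b, (a, b) ∈ A → b ∉ S → Ar (A \ H) a b := by
    intro a b hab ha
    exact Finset.mem_sdiff.2 ⟨hab, fun h => ha (mem_sub.1 h).2.2⟩
  have hein : ¬ (e.1 ∈ S ∧ e.2 ∈ S) := by
    rintro ⟨h1, h2⟩
    refine (hV e he).2.2 (noreach _ h1 _ h2 (ReflTransGen.single ?_))
    exact Finset.mem_sdiff.2 ⟨he, fun h => by simp [hHdef, mem_sub] at h⟩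
  obtain ⟨z, hzV, hzS⟩ : ∃ z ∈ V, z ∉ S := by
    by_cases h1 : e.1 ∈ S
    · exact ⟨e.2, (hV e he).2.1, fun h => hein ⟨h1, h⟩⟩
    · exact ⟨e.1, (hV e he).1, h1⟩
  have hfrom : ∀ z, ReflTransGen (Ar A) s z → ∃ x ∈ S, ReflTransGen (Ar (A \ H)) x z := by
    intro z hz
    induction hz with
    | refl => exact ⟨s, hsS, .refl⟩
    | @tail b c _ hbc ih =>
      by_cases hc : c ∈ S
      · exact ⟨c, hc, .refl⟩
      · obtain ⟨x, hx, hr⟩ := ih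
        exact ⟨x, hx, hr.tail (hB2 _ _ hbc hc)⟩
  have hto : ∀ z, ReflTransGen (Ar A) z s → ∃ x ∈ S, ReflTransGen (Ar (A \ H)) z x := by
    intro z hz
    induction hz using ReflTransGen.head_induction_on with
    | refl => exact ⟨s, hsS, .refl⟩
    | @head b c hbc _ ih =>
      by_cases hc : b ∈ S
      · exact ⟨b, hc, .refl⟩
      · obtain ⟨x, hx, hr⟩ := ih
        exact ⟨x, hx, hr.head (hB1 _ _ hbc hc)⟩
  obtain ⟨x0, hx0, hr0⟩ := hfrom z (hstr s (hSV hsS) z hzV)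
  obtain ⟨x1, hx1, hr1⟩ := hto z (hstr z hzV s (hSV hsS))
  obtain rfl := noreach _ hx0 _ hx1 (hr0.trans hr1)
  obtain ⟨t, htS, ht⟩ : ∃ t ∈ S, t ≠ x0 := by
    by_cases h : s = x0
    · exact ⟨s', hsS', fun h' => hss (h.trans h'.symm)⟩
    · exact ⟨s, hsS, h⟩
  have hwalk := hnc x0 (hSV hx0) z hzV t (hSV htS) (fun h => hzS (h ▸ hx0)) ht
  have hinv : ∀ t, ReflTransGen (Adv A x0) z t →
      t ∉ S ∧ ReflTransGen (Ar (A \ H)) x0 t ∧ ReflTransGen (Ar (A \ H)) t x0 := by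
    intro t ht
    induction ht with
    | refl => exact ⟨hzS, hr0, hr1⟩
    | @tail b c _ hbc ih =>
      obtain ⟨hbS, h1, h2⟩ := ih
      obtain ⟨hadj, _, hc⟩ := hbc
      rcases hadj with hA | hA
      · have h3 := h1.tail (hB1 _ _ hA hbS)
        have hcS : c ∉ S := fun h => hc (noreach _ hx0 _ h h3).symm
        obtain ⟨y, hy, hcy⟩ := hto c (hstr _ (hV _ hA).2.1 _ (hSV hsS))
        obtain rfl := noreach _ hx0 _ hy (h3.trans hcy)
        exact ⟨hcS, h3, hcy⟩
      · have h3 := h2.head (hB2 _ _ hA hbS)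
        have hcS : c ∉ S := fun h => hc (noreach _ h _ hx0 h3)
        obtain ⟨y, hy, hcy⟩ := hfrom c (hstr _ (hSV hsS) _ (hV _ hA).1)
        obtain rfl := noreach _ hy _ hx0 (hcy.trans h3)
        exact ⟨hcS, hcy, h3⟩
  exact (hinv t hwalk).1 htS

/-- Reduced form of extremality. -/
def Ex (k : ℕ) (V : Finset ℕ) (A : Finset (ℕ × ℕ)) : Prop :=
  NoCut V A ∧ Str V A ∧ ¬ Col A k ∧ Sep V A k

lemma ureach_del {D : Dgraph} (hD : D.WF) (c : ℕ) :
    (D.delVert c).adj = Adv D.arcs c := by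
  ext a b
  simp only [Dgraph.adj, Dgraph.delVert, Dgraph.induce, Adv, Finset.mem_filter, Finset.mem_erase]
  have h1 := hD (a, b)
  have h2 := hD (b, a)
  simp only at h1 h2
  tauto

lemma lam_le_iff {D : Dgraph} (hD : D.WF) (k : ℕ) : D.lam ≤ k ↔ Sep D.verts D.arcs k := by
  have hfin : BddAbove {n | ∃ u ∈ D.verts, ∃ v ∈ D.verts, u ≠ v ∧ n = D.locLam u v} := by
    refine Set.Finite.bddAbove (Set.Finite.subset
      ((D.verts ×ˢ D.verts).image (fun a => D.locLam a.1 a.2)).finite_toSet ?_)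
    rintro n ⟨u, hu, v, hv, _, rfl⟩
    simp only [Finset.coe_image, Set.mem_image, Finset.mem_coe, Finset.mem_product]
    exact ⟨(u, v), ⟨hu, hv⟩, rfl⟩
  have key : ∀ x ∈ D.verts, ∀ y, x ≠ y → (D.locLam x y ≤ k ↔
      ∃ X : Finset ℕ, x ∈ X ∧ y ∉ X ∧ (cut D.arcs X).card ≤ k) := by
    intro x hx y hxy
    have := le_locLam_iff hD hx hxy (k + 1)
    constructor
    · intro h
      by_contra hc
      push Not at hc
      have := this.2 (fun X h1 h2 => hc X h1 h2)
      omega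
    · rintro ⟨X, h1, h2, h3⟩
      by_contra hc
      have := this.1 (by omega) X h1 h2
      omega
  constructor
  · intro h x hx y hy hxy
    refine (key x hx y hxy).1 (le_trans (le_csSup hfin ⟨x, hx, y, hy, hxy, rfl⟩) h)
  · intro h
    apply csSup_le'
    rintro n ⟨x, hx, y, hy, hxy, rfl⟩
    exact (key x hx y hxy).2 (h x hx y hy hxy)

lemma le_lam {D : Dgraph} (hD : D.WF) {k x y : ℕ} (hx : x ∈ D.verts) (hy : y ∈ D.verts)
    (hxy : x ≠ y) (h : ∀ X : Finset ℕ, x ∈ X → y ∉ X → k ≤ (cut D.arcs X).card) :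
    k ≤ D.lam := by
  by_contra hlt
  obtain ⟨X, h1, h2, h3⟩ := (lam_le_iff hD (k - 1)).1 (by omega) x hx y hy hxy
  have := h X h1 h2
  omega

lemma extremal_iff {D : Dgraph} (hD : D.WF) {k : ℕ} (hk : 1 ≤ k) :
    D.Extremal k ↔ Ex k D.verts D.arcs := by
  have hdel : ∀ c, (D.delVert c).verts = D.verts.erase c := by
    intro c
    simp only [Dgraph.delVert, Dgraph.induce]
    exact Finset.inter_eq_right.2 (Finset.erase_subset _ _)
  constructor
  · rintro ⟨⟨_, h2⟩, h3, h4, h5⟩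
    refine ⟨?_, (strong_iff hD).1 h3, ((dichi_iff hD k).1 h4).2, (lam_le_iff hD k).1 h5.le⟩
    intro c hc x hx y hy hxc hyc
    have h6 : (D.delVert c).UConnected := by
      by_contra hcon
      exact h2 c ⟨hc, hcon⟩
    have h7 := h6.2 x (by rw [hdel]; simp [hx, hxc]) y (by rw [hdel]; simp [hy, hyc])
    unfold Dgraph.UReach at h7
    rwa [ureach_del hD] at h7
  · rintro ⟨h1, h2, h3, h4⟩
    obtain ⟨S, hS, ⟨x, hx, y, hy, hxy⟩, hc⟩ := exists_core hD hk h3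
    obtain ⟨e, he⟩ : D.arcs.Nonempty := by
      rw [Finset.nonempty_iff_ne_empty]
      intro h0
      exact h3 ⟨fun _ => ⟨0, hk⟩, fun _ => 0, by simp [h0]⟩
    refine ⟨⟨⟨⟨x, hS hx⟩, ?_⟩, ?_⟩, (strong_iff hD).2 h2, (dichi_iff hD k).2 ⟨?_, h3⟩, ?_⟩
    · intro a ha b hb
      exact ReflTransGen.mono (fun p q h => Or.inl h) _ _ (h2 a ha b hb)
    · rintro c ⟨hcV, hcon⟩
      apply hcon
      refine ⟨?_, ?_⟩
      · rw [hdel]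
        by_cases h : x = c
        · exact ⟨y, by simp [hS hy]; exact fun h' => hxy (h.trans h'.symm)⟩
        · exact ⟨x, by simp [hS hx, h]⟩
      · intro a ha b hb
        rw [hdel, Finset.mem_erase] at ha hb
        unfold Dgraph.UReach
        rw [ureach_del hD]
        exact h1 c hcV a ha.2 b hb.2 ha.1 hb.1
    · exact Col.succ_of_erase (p := e.1) (q := e.2) (hD e he).2.2 (critical hD hk h2 h1 h4 he)
    · refine le_antisymm ((lam_le_iff hD k).2 h4) (le_lam hD (hS hx) (hS hy) hxy ?_)
      intro X hxX hyX
      refine (hc x hx y hy X hxX hyX).trans (Finset.card_le_card ?_)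
      intro a ha
      rw [mem_cut, mem_sub] at ha
      exact mem_cut.2 ⟨ha.1.1, ha.2⟩

end HJ
namespace HJ

open Relation

/-- Reversal. -/
def rev (A : Finset (ℕ × ℕ)) : Finset (ℕ × ℕ) := A.image Prod.swap

lemma mem_rev {A : Finset (ℕ × ℕ)} {a b : ℕ} : (a, b) ∈ rev A ↔ (b, a) ∈ A := by
  simp [rev, Prod.swap]

lemma Wf.rev {V : Finset ℕ} {A : Finset (ℕ × ℕ)} (h : Wf V A) : Wf V (rev A) := by
  rintro ⟨a, b⟩ hab
  have := h _ (mem_rev.1 hab)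
  exact ⟨this.2.1, this.1, this.2.2.symm⟩

lemma Col.rev {A : Finset (ℕ × ℕ)} {k : ℕ} (h : Col A k) : Col (rev A) k := by
  obtain ⟨φ, f, hf⟩ := h
  refine ⟨φ, fun z => - f z, ?_⟩
  rintro ⟨a, b⟩ hab hc
  have := hf _ (mem_rev.1 hab) hc.symm
  simp only at this ⊢
  linarith

lemma rev_rev (A : Finset (ℕ × ℕ)) : rev (rev A) = A := by
  ext ⟨a, b⟩
  rw [mem_rev, mem_rev]

lemma Ex.rev {k : ℕ} {V : Finset ℕ} {A : Finset (ℕ × ℕ)} (hV : Wf V A) (h : Ex k V A) :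
    Ex k V (rev A) := by
  obtain ⟨h1, h2, h3, h4⟩ := h
  refine ⟨?_, ?_, ?_, ?_⟩
  · intro c hc x hx y hy hxc hyc
    refine ReflTransGen.mono ?_ _ _ (h1 c hc x hx y hy hxc hyc)
    rintro a b ⟨h, h'⟩
    exact ⟨by rw [mem_rev, mem_rev]; exact h.symm, h'⟩
  · intro x hx y hy
    have := (h2 y hy x hx).swap
    refine ReflTransGen.mono ?_ _ _ this
    intro a b h
    exact mem_rev.2 h
  · intro h
    apply h3
    rw [← rev_rev A]
    exact h.rev
  · intro x hx y hy hxy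
    obtain ⟨X, hyX, hxX, hX⟩ := h4 y hy x hx hxy.symm
    refine ⟨V \ X, by simp [hx, hxX], by simp [hyX], le_trans ?_ hX⟩
    apply Finset.card_le_card_of_injOn Prod.swap
    · rintro ⟨a, b⟩ hab
      have hab := mem_cut.1 hab
      have h5 := mem_rev.1 hab.1
      have h6 := (hV _ h5).1
      simp only [Finset.mem_sdiff, not_and, not_not] at hab
      exact mem_cut.2 ⟨h5, hab.2.2 h6, hab.2.1.2⟩
    · exact Prod.swap_injective.injOn

/-- Data of a join of digraphs sharing exactly the vertex `v`. -/
structure Join (V1 V2 : Finset ℕ) (A1 A2 : Finset (ℕ × ℕ)) (u v w : ℕ) : Prop where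
  wf1 : Wf V1 A1
  wf2 : Wf V2 A2
  inter : ∀ z, z ∈ V1 → z ∈ V2 → z = v
  uv : (u, v) ∈ A1
  vw : (v, w) ∈ A2

/-- Arcs of the join. -/
def jn (A1 A2 : Finset (ℕ × ℕ)) (u v w : ℕ) : Finset (ℕ × ℕ) :=
  insert (u, w) (A1.erase (u, v) ∪ A2.erase (v, w))

lemma mem_jn {A1 A2 : Finset (ℕ × ℕ)} {u v w : ℕ} {a b : ℕ} : (a, b) ∈ jn A1 A2 u v w ↔
    (a = u ∧ b = w) ∨ ((a, b) ∈ A1 ∧ ¬ (a = u ∧ b = v)) ∨ ((a, b) ∈ A2 ∧ ¬ (a = v ∧ b = w)) := by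
  simp only [jn, Finset.mem_insert, Finset.mem_union, Finset.mem_erase, Prod.mk.injEq, ne_eq]
  tauto

lemma jn_rev (A1 A2 : Finset (ℕ × ℕ)) (u v w : ℕ) :
    rev (jn A1 A2 u v w) = jn (rev A2) (rev A1) w v u := by
  ext ⟨a, b⟩
  rw [mem_rev, mem_jn, mem_jn, mem_rev, mem_rev]
  tauto

variable {V1 V2 : Finset ℕ} {A1 A2 : Finset (ℕ × ℕ)} {u v w : ℕ}

lemma Join.rev (J : Join V1 V2 A1 A2 u v w) : Join V2 V1 (rev A2) (rev A1) w v u where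
  wf1 := J.wf2.rev
  wf2 := J.wf1.rev
  inter := fun z h1 h2 => J.inter z h2 h1
  uv := mem_rev.2 J.vw
  vw := mem_rev.2 J.uv

lemma Join.facts (J : Join V1 V2 A1 A2 u v w) : u ∈ V1 ∧ v ∈ V1 ∧ v ∈ V2 ∧ w ∈ V2 ∧ u ≠ v ∧
    w ≠ v ∧ u ∉ V2 ∧ w ∉ V1 := by
  have h1 := J.wf1 _ J.uv
  have h2 := J.wf2 _ J.vw
  simp only at h1 h2
  exact ⟨h1.1, h1.2.1, h2.1, h2.2.1, h1.2.2, h2.2.2.symm,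
    fun h => h1.2.2 (J.inter _ h1.1 h), fun h => h2.2.2 (J.inter _ h h2.2.1).symm⟩

lemma Join.wf (J : Join V1 V2 A1 A2 u v w) : Wf (V1 ∪ V2) (jn A1 A2 u v w) := by
  obtain ⟨h1, h2, h3, h4, h5, h6, h7, h8⟩ := J.facts
  rintro ⟨a, b⟩ hab
  simp only [Finset.mem_union]
  rcases mem_jn.1 hab with ⟨rfl, rfl⟩ | ⟨h, _⟩ | ⟨h, _⟩
  · exact ⟨Or.inl h1, Or.inr h4, fun h => h8 (h ▸ h1)⟩
  · have := J.wf1 _ h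
    exact ⟨Or.inl this.1, Or.inl this.2.1, this.2.2⟩
  · have := J.wf2 _ h
    exact ⟨Or.inr this.1, Or.inr this.2.1, this.2.2⟩

lemma not_col_join {k : ℕ} (h1 : ¬ Col A1 k) (h2 : ¬ Col A2 k) : ¬ Col (jn A1 A2 u v w) k := by
  rintro ⟨φ, f, hf⟩
  have hf' : ∀ a b, (a, b) ∈ jn A1 A2 u v w → φ a = φ b → f a < f b := fun a b h => hf (a, b) h
  have c1 : φ u = φ v ∧ f v ≤ f u := by
    by_contra hc
    apply h1
    refine ⟨φ, f, ?_⟩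
    rintro ⟨a, b⟩ hab hcol
    by_cases h : a = u ∧ b = v
    · obtain ⟨rfl, rfl⟩ := h
      by_contra hlt
      exact hc ⟨hcol, not_lt.1 hlt⟩
    · exact hf' a b (mem_jn.2 (Or.inr (Or.inl ⟨hab, h⟩))) hcol
  have c2 : φ v = φ w ∧ f w ≤ f v := by
    by_contra hc
    apply h2
    refine ⟨φ, f, ?_⟩
    rintro ⟨a, b⟩ hab hcol
    by_cases h : a = v ∧ b = w
    · obtain ⟨rfl, rfl⟩ := h
      by_contra hlt
      exact hc ⟨hcol, not_lt.1 hlt⟩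
    · exact hf' a b (mem_jn.2 (Or.inr (Or.inr ⟨hab, h⟩))) hcol
  have := hf' u w (mem_jn.2 (Or.inl ⟨rfl, rfl⟩)) (c1.1.trans c2.1)
  linarith [c1.2, c2.2]

lemma col_join (J : Join V1 V2 A1 A2 u v w) {k : ℕ} (h1 : Col A1 k) (h2 : Col (A2.erase (v, w)) k) :
    Col (jn A1 A2 u v w) k := by
  obtain ⟨hu1, hv1, hv2, hw2, huv, hwv, hu2, hw1⟩ := J.facts
  obtain ⟨φ1, f1, hf1⟩ := h1
  obtain ⟨φ2, f2, hf2⟩ := h2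
  set σ := Equiv.swap (φ2 v) (φ1 v) with hσ
  set φ : ℕ → Fin k := fun z => if z ∈ V1 then φ1 z else σ (φ2 z) with hφ
  have e1 : ∀ z ∈ V1, φ z = φ1 z := fun z hz => by simp [hφ, hz]
  have e2 : ∀ z ∈ V2, φ z = σ (φ2 z) := by
    intro z hz
    by_cases h : z ∈ V1
    · have := J.inter z h hz
      subst this
      simp [hφ, h, hσ]
    · simp [hφ, h]
  set N : ℤ := |f2 w - f2 v| + 1 with hN
  set M : ℤ := f1 u - f2 w + f2 v + 1 with hM
  set f : ℕ → ℤ := fun z => if z ∈ V1 then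
    (if φ1 z = φ1 v then N * (f1 z - f1 v) else f1 z - M) else f2 z - f2 v with hf
  have g1 : ∀ z ∈ V1, φ1 z = φ1 v → f z = N * (f1 z - f1 v) := fun z hz h => by simp [hf, hz, h]
  have g1' : ∀ z ∈ V1, φ1 z ≠ φ1 v → f z = f1 z - M := fun z hz h => by simp [hf, hz, h]
  have g2 : ∀ z ∈ V2, f z = f2 z - f2 v := by
    intro z hz
    by_cases h : z ∈ V1
    · have := J.inter z h hz
      subst this
      simp [hf, h]
    · simp [hf, h]
  have hNpos : 0 < N := by positivity
  refine ⟨φ, f, ?_⟩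
  rintro ⟨a, b⟩ hab hcol
  simp only at hcol ⊢
  rcases mem_jn.1 hab with ⟨rfl, rfl⟩ | ⟨h, _⟩ | ⟨h, h'⟩
  · rw [g2 b hw2]
    by_cases hc : φ1 a = φ1 v
    · rw [g1 a hu1 hc]
      have h3 := hf1 _ J.uv hc
      simp only at h3
      have h4 : N * (f1 a - f1 v) ≤ N * (-1) := by
        apply mul_le_mul_of_nonneg_left _ hNpos.le
        omega
      have h5 := neg_abs_le (f2 b - f2 v)
      linarith
    · rw [g1' a hu1 hc]
      linarith
  · have hw := J.wf1 _ h
    simp only at hw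
    rw [e1 a hw.1, e1 b hw.2.1] at hcol
    have h3 := hf1 _ h hcol
    simp only at h3
    by_cases hc : φ1 a = φ1 v
    · rw [g1 a hw.1 hc, g1 b hw.2.1 (hcol ▸ hc)]
      apply mul_lt_mul_of_pos_left _ hNpos
      linarith
    · rw [g1' a hw.1 hc, g1' b hw.2.1 (hcol ▸ hc)]
      linarith
  · have hw := J.wf2 _ h
    simp only at hw
    rw [e2 a hw.1, e2 b hw.2.1] at hcol
    have h3 := hf2 (a, b) (by simp [h]; simpa using h') (σ.injective hcol)
    rw [g2 a hw.1, g2 b hw.2.1]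
    simp only at h3
    linarith

/-- Arcs entering the start vertex can be dropped. -/
lemma reach_erase_start {A : Finset (ℕ × ℕ)} {s t z : ℕ} (h : ReflTransGen (Ar A) s z) :
    ReflTransGen (Ar (A.erase (t, s))) s z := by
  induction h with
  | refl => exact .refl
  | @tail b c _ hbc ih =>
    by_cases hc : c = s
    · rw [hc]
    · exact ih.tail (Finset.mem_erase.2 ⟨by simp [hc], hbc⟩)

/-- Arcs leaving the end vertex can be dropped. -/
lemma reach_erase_end {A : Finset (ℕ × ℕ)} {s t z : ℕ} (h : ReflTransGen (Ar A) z s) :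
    ReflTransGen (Ar (A.erase (s, t))) z s := by
  induction h using ReflTransGen.head_induction_on with
  | refl => exact .refl
  | @head b c hbc _ ih =>
    by_cases hc : b = s
    · rw [hc]
    · exact ih.head (Finset.mem_erase.2 ⟨by simp [hc], hbc⟩)

lemma str_join_left (J : Join V1 V2 A1 A2 u v w) (h : Str (V1 ∪ V2) (jn A1 A2 u v w)) :
    Str V1 A1 := by
  obtain ⟨hu1, hv1, hv2, hw2, huv, hwv, hu2, hw1⟩ := J.facts
  intro x hx y hy
  have h1 := h x (Finset.mem_union_left _ hx) y (Finset.mem_union_left _ hy)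
  have h2 := ReflTransGen.lift' (p := Ar A1) (fun z => if z ∈ V1 then z else v) (by
    intro a b hab
    rcases mem_jn.1 hab with ⟨rfl, rfl⟩ | ⟨h, _⟩ | ⟨h, _⟩
    · simp only [Function.onFun, hu1, hw1, if_true, if_false]
      exact .single J.uv
    · have hw := J.wf1 _ h
      simp only at hw
      simp only [Function.onFun, hw.1, hw.2.1, if_true]
      exact .single h
    · have hw := J.wf2 _ h
      simp only at hw
      have : ∀ z ∈ V2, (if z ∈ V1 then z else v) = v := by
        intro z hz
        split_ifs with h
        · exact J.inter z h hz
        · rfl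
      simp only [Function.onFun, this a hw.1, this b hw.2.1]
      exact .refl) x y h1
  simpa [Function.onFun, hx, hy] using h2

lemma nocut_join_left (J : Join V1 V2 A1 A2 u v w) (h : NoCut (V1 ∪ V2) (jn A1 A2 u v w)) :
    NoCut V1 A1 := by
  obtain ⟨hu1, hv1, hv2, hw2, huv, hwv, hu2, hw1⟩ := J.facts
  intro c hc x hx y hy hxc hyc
  have h1 := h c (Finset.mem_union_left _ hc) x (Finset.mem_union_left _ hx) y
    (Finset.mem_union_left _ hy) hxc hyc
  set t := if c = v then u else v with ht
  have htc : t ≠ c := by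
    rw [ht]; split_ifs with h
    · rw [h]; exact huv
    · exact fun h' => h h'.symm
  set g : ℕ → ℕ := fun z => if z ∈ V1 then z else t with hg
  have g1 : ∀ z ∈ V1, g z = z := fun z hz => by simp [hg, hz]
  have g2 : ∀ z ∈ V2, z ≠ c → g z = t := by
    intro z hz hzc
    simp only [hg]
    split_ifs with h
    · have := J.inter z h hz
      subst this
      rw [ht, if_neg (fun h => hzc h.symm)]
    · rfl
  have harc : ∀ a b, (a, b) ∈ jn A1 A2 u v w → a ≠ c → b ≠ c →
      g a = g b ∨ Adv A1 c (g a) (g b) := by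
    intro a b hab hac hbc
    rcases mem_jn.1 hab with ⟨rfl, rfl⟩ | ⟨h, _⟩ | ⟨h, _⟩
    · rw [g1 a hu1, g2 b hw2 hbc, ht]
      split_ifs with h
      · exact Or.inl rfl
      · exact Or.inr ⟨Or.inl J.uv, hac, fun h' => h h'.symm⟩
    · have hw := J.wf1 _ h
      rw [g1 a hw.1, g1 b hw.2.1]
      exact Or.inr ⟨Or.inl h, hac, hbc⟩
    · have hw := J.wf2 _ h
      exact Or.inl (by rw [g2 a hw.1 hac, g2 b hw.2.1 hbc])
  have h2 := ReflTransGen.lift' (p := Adv A1 c) g (by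
    rintro a b ⟨hab, hac, hbc⟩
    rcases hab with hab | hab
    · rcases harc a b hab hac hbc with h | h
      · simp only [Function.onFun, h]; exact .refl
      · exact .single h
    · rcases harc b a hab hbc hac with h | h
      · simp only [Function.onFun, h]; exact .refl
      · exact .single ⟨h.1.symm, h.2.2, h.2.1⟩) x y h1
  simpa [Function.onFun, g1 x hx, g1 y hy] using h2

lemma sep_join_left (J : Join V1 V2 A1 A2 u v w) {k : ℕ} (h2 : Str V2 A2)
    (h : Sep (V1 ∪ V2) (jn A1 A2 u v w) k) : Sep V1 A1 k := by
  obtain ⟨hu1, hv1, hv2, hw2, huv, hwv, hu2, hw1⟩ := J.facts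
  intro x hx y hy hxy
  obtain ⟨X, hxX, hyX, hX⟩ := h x (Finset.mem_union_left _ hx) y (Finset.mem_union_left _ hy) hxy
  refine ⟨X, hxX, hyX, le_trans ?_ hX⟩
  have hsub : (cut A1 X).erase (u, v) ⊆ cut (jn A1 A2 u v w) X := by
    rintro ⟨a, b⟩ hab
    rw [Finset.mem_erase, mem_cut] at hab
    exact mem_cut.2 ⟨mem_jn.2 (Or.inr (Or.inl ⟨hab.2.1, by simpa using hab.1⟩)), hab.2.2⟩
  by_cases hc : (u, v) ∈ cut A1 X
  · have hcr := mem_cut.1 hc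
    have hr : ReflTransGen (Ar (insert (u, w) (A2.erase (v, w)))) u v :=
      ReflTransGen.head (b := w) (Finset.mem_insert_self _ _)
        (ReflTransGen.mono (fun a b h => Finset.mem_insert_of_mem h) _ _
          (reach_erase_end (t := w) (h2 w hw2 v hv2)))
    obtain ⟨a, b, hab, haX, hbX⟩ := reach_cross hr (fun z => z ∈ X) hcr.2.1 hcr.2.2
    have hnot : (a, b) ∉ A1 := by
      intro h1
      have hw := J.wf1 _ h1
      simp only at hw
      rcases Finset.mem_insert.1 hab with h | h
      · simp at h
        exact hw1 (h.2 ▸ hw.2.1)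
      · have hw' := J.wf2 _ (Finset.mem_of_mem_erase h)
        exact hw.2.2 ((J.inter a hw.1 hw'.1).trans (J.inter b hw.2.1 hw'.2.1).symm)
    have hin : (a, b) ∈ cut (jn A1 A2 u v w) X := by
      refine mem_cut.2 ⟨?_, haX, hbX⟩
      rw [jn]
      rcases Finset.mem_insert.1 hab with h | h
      · rw [h]; exact Finset.mem_insert_self _ _
      · exact Finset.mem_insert_of_mem (Finset.mem_union_right _ h)
    have hle := Finset.card_le_card (Finset.insert_subset hin hsub)
    rw [Finset.card_insert_of_notMem (by
      intro hh
      exact hnot (mem_cut.1 (Finset.mem_of_mem_erase hh)).1), Finset.card_erase_of_mem hc] at hle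
    have := Finset.card_pos.2 ⟨_, hc⟩
    omega
  · rw [Finset.erase_eq_of_notMem hc] at hsub
    exact Finset.card_le_card hsub

/-- Extremality passes to the left part. -/
lemma ex_join_left (J : Join V1 V2 A1 A2 u v w) {k : ℕ} (hk : 1 ≤ k)
    (h : Ex k (V1 ∪ V2) (jn A1 A2 u v w)) :
    NoCut V1 A1 ∧ Str V1 A1 ∧ (Str V2 A2 → Sep V1 A1 k) ∧
      (NoCut V2 A2 → Str V2 A2 → Sep V2 A2 k → ¬ Col A1 k) := by
  obtain ⟨h1, h2, h3, h4⟩ := h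
  refine ⟨nocut_join_left J h1, str_join_left J h2, fun h => sep_join_left J h h4, ?_⟩
  intro g1 g2 g3 hcol
  exact h3 (col_join J hcol (critical J.wf2 hk g2 g1 g3 J.vw))

lemma ex_of_join (J : Join V1 V2 A1 A2 u v w) {k : ℕ} (hk : 1 ≤ k)
    (h : Ex k (V1 ∪ V2) (jn A1 A2 u v w)) : Ex k V1 A1 ∧ Ex k V2 A2 := by
  have h' := h.rev J.wf
  rw [jn_rev, Finset.union_comm] at h'
  obtain ⟨a1, a2, a3, a4⟩ := ex_join_left J hk h
  obtain ⟨b1, b2, b3, b4⟩ := ex_join_left J.rev hk h'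
  have strrev : ∀ (V : Finset ℕ) A, Str V A → Str V (rev A) := by
    intro V A h x hx y hy
    refine ReflTransGen.mono ?_ _ _ (h y hy x hx).swap
    intro a b h
    exact mem_rev.2 h
  have ncrev : ∀ (V : Finset ℕ) A, NoCut V A → NoCut V (rev A) := by
    intro V A h1 c hc x hx y hy hxc hyc
    refine ReflTransGen.mono ?_ _ _ (h1 c hc x hx y hy hxc hyc)
    rintro a b ⟨h, h'⟩
    exact ⟨by rw [mem_rev, mem_rev]; exact h.symm, h'⟩
  have s2 := strrev _ _ b2
  have n2 := ncrev _ _ b1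
  rw [rev_rev] at s2 n2
  have s1' := strrev _ _ a2
  have p1 := a3 s2
  have p2' := b3 s1'
  have sr : Sep V2 A2 k := by
    have : ∀ (V : Finset ℕ) A, Wf V A → Sep V A k → Sep V (rev A) k := by
      intro V A hV h4 x hx y hy hxy
      obtain ⟨X, hyX, hxX, hX⟩ := h4 y hy x hx hxy.symm
      refine ⟨V \ X, by simp [hx, hxX], by simp [hyX], le_trans ?_ hX⟩
      apply Finset.card_le_card_of_injOn Prod.swap
      · rintro ⟨a, b⟩ hab
        have hab := mem_cut.1 hab
        have h5 := mem_rev.1 hab.1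
        have h6 := (hV _ h5).1
        simp only [Finset.mem_sdiff, not_and, not_not] at hab
        exact mem_cut.2 ⟨h5, hab.2.2 h6, hab.2.1.2⟩
      · exact Prod.swap_injective.injOn
    have := this _ _ J.wf2.rev p2'
    rwa [rev_rev] at this
  have hn1 := a4 n2 s2 sr
  have e1 : Ex k V1 A1 := ⟨a1, a2, hn1, p1⟩
  obtain ⟨r1, r2, r3, r4⟩ := e1.rev J.wf1
  exact ⟨e1, n2, s2, fun hc => b4 r1 r2 r4 hc.rev, sr⟩

lemma sep_join (J : Join V1 V2 A1 A2 u v w) {k : ℕ} (s1 : Sep V1 A1 k) (s2 : Sep V2 A2 k) :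
    Sep (V1 ∪ V2) (jn A1 A2 u v w) k := by
  obtain ⟨hu1, hv1, hv2, hw2, huv, hwv, hu2, hw1⟩ := J.facts
  set g : ℕ → ℕ := fun z => if z ∈ V1 then z else v with hg
  set g' : ℕ → ℕ := fun z => if z ∈ V2 then z else v with hg'
  have e1 : ∀ z ∈ V1, g z = z := fun z hz => by simp [hg, hz]
  have e2 : ∀ z ∈ V2, g z = v := by
    intro z hz
    simp only [hg]
    split_ifs with h
    · exact J.inter z h hz
    · rfl
  have e1' : ∀ z ∈ V1, g' z = v := by
    intro z hz
    simp only [hg']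
    split_ifs with h
    · exact J.inter z hz h
    · rfl
  have e2' : ∀ z ∈ V2, g' z = z := fun z hz => by simp [hg', hz]
  have gm : ∀ z, g z ∈ V1 := by
    intro z; simp only [hg]; split_ifs with h <;> assumption
  have gm' : ∀ z, g' z ∈ V2 := by
    intro z; simp only [hg']; split_ifs with h <;> assumption
  intro x hx y hy hxy
  by_cases hgg : g x = g y
  · have hgg' : g' x ≠ g' y := by
      intro hgg'
      rcases Finset.mem_union.1 hx with hx | hx <;> rcases Finset.mem_union.1 hy with hy | hy
      · rw [e1 x hx, e1 y hy] at hgg; exact hxy hgg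
      · rw [e1 x hx, e2 y hy] at hgg
        rw [e1' x hx, e2' y hy] at hgg'
        exact hxy (hgg.trans hgg')
      · rw [e2 x hx, e1 y hy] at hgg
        rw [e2' x hx, e1' y hy] at hgg'
        exact hxy (hgg'.trans hgg)
      · rw [e2' x hx, e2' y hy] at hgg'; exact hxy hgg'
    obtain ⟨X, hxX, hyX, hX⟩ := s2 _ (gm' x) _ (gm' y) hgg'
    refine ⟨(V1 ∪ V2).filter (fun z => g' z ∈ X), by simpa [hxX] using Finset.mem_union.1 hx,
      by simp [hyX], le_trans ?_ hX⟩
    have himg : ∀ a b, (a, b) ∈ cut (jn A1 A2 u v w) ((V1 ∪ V2).filter (fun z => g' z ∈ X)) →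
        (a = u ∧ b = w ∧ g' a = v ∧ g' b = w) ∨
        ((a, b) ∈ A2 ∧ ¬ (a = v ∧ b = w) ∧ g' a = a ∧ g' b = b) := by
      intro a b hab
      rw [mem_cut] at hab
      obtain ⟨h1, h2, h3⟩ := hab
      have hb := (J.wf _ h1).2.1
      simp only [Finset.mem_filter] at h2 h3 hb
      rcases mem_jn.1 h1 with ⟨rfl, rfl⟩ | ⟨h, _⟩ | ⟨h, h'⟩
      · exact Or.inl ⟨rfl, rfl, e1' _ hu1, e2' _ hw2⟩
      · have hw := J.wf1 _ h
        exfalso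
        apply h3
        refine ⟨hb, ?_⟩
        rw [e1' b hw.2.1, ← e1' a hw.1]
        exact h2.2
      · have hw := J.wf2 _ h
        exact Or.inr ⟨h, h', e2' a hw.1, e2' b hw.2.1⟩
    apply Finset.card_le_card_of_injOn (fun a => (g' a.1, g' a.2))
    · rintro ⟨a, b⟩ hab
      have h0 := mem_cut.1 hab
      have hb := (J.wf _ h0.1).2.1
      simp only [Finset.mem_filter, not_and] at h0 hb
      refine mem_cut.2 ⟨?_, h0.2.1.2, h0.2.2 hb⟩
      rcases himg a b hab with ⟨_, _, h1, h2⟩ | ⟨h, _, h1, h2⟩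
      · simp only [h1, h2]; exact J.vw
      · simp only [h1, h2]; exact h
    · rintro ⟨a, b⟩ hab ⟨c, d⟩ hcd heq
      simp only [Prod.mk.injEq] at heq ⊢
      rcases himg a b hab with ⟨p1, p2, p3, p4⟩ | ⟨p1, p2, p3, p4⟩ <;>
        rcases himg c d hcd with ⟨q1, q2, q3, q4⟩ | ⟨q1, q2, q3, q4⟩ <;>
        rw [p3, p4, q3, q4] at heq
      · exact ⟨p1.trans q1.symm, p2.trans q2.symm⟩
      · exact absurd ⟨heq.1.symm, heq.2.symm⟩ q2
      · exact absurd heq p2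
      · exact heq
  · obtain ⟨X, hxX, hyX, hX⟩ := s1 _ (gm x) _ (gm y) hgg
    refine ⟨(V1 ∪ V2).filter (fun z => g z ∈ X), by simpa [hxX] using Finset.mem_union.1 hx,
      by simp [hyX], le_trans ?_ hX⟩
    have himg : ∀ a b, (a, b) ∈ cut (jn A1 A2 u v w) ((V1 ∪ V2).filter (fun z => g z ∈ X)) →
        (a = u ∧ b = w ∧ g a = u ∧ g b = v) ∨
        ((a, b) ∈ A1 ∧ ¬ (a = u ∧ b = v) ∧ g a = a ∧ g b = b) := by
      intro a b hab
      rw [mem_cut] at hab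
      obtain ⟨h1, h2, h3⟩ := hab
      have hb := (J.wf _ h1).2.1
      simp only [Finset.mem_filter] at h2 h3 hb
      rcases mem_jn.1 h1 with ⟨rfl, rfl⟩ | ⟨h, h'⟩ | ⟨h, _⟩
      · exact Or.inl ⟨rfl, rfl, e1 _ hu1, e2 _ hw2⟩
      · have hw := J.wf1 _ h
        exact Or.inr ⟨h, h', e1 a hw.1, e1 b hw.2.1⟩
      · have hw := J.wf2 _ h
        exfalso
        apply h3
        refine ⟨hb, ?_⟩
        rw [e2 b hw.2.1, ← e2 a hw.1]
        exact h2.2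
    apply Finset.card_le_card_of_injOn (fun a => (g a.1, g a.2))
    · rintro ⟨a, b⟩ hab
      have h0 := mem_cut.1 hab
      have hb := (J.wf _ h0.1).2.1
      simp only [Finset.mem_filter, not_and] at h0 hb
      refine mem_cut.2 ⟨?_, h0.2.1.2, h0.2.2 hb⟩
      rcases himg a b hab with ⟨_, _, h1, h2⟩ | ⟨h, _, h1, h2⟩
      · simp only [h1, h2]; exact J.uv
      · simp only [h1, h2]; exact h
    · rintro ⟨a, b⟩ hab ⟨c, d⟩ hcd heq
      simp only [Prod.mk.injEq] at heq ⊢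
      rcases himg a b hab with ⟨p1, p2, p3, p4⟩ | ⟨p1, p2, p3, p4⟩ <;>
        rcases himg c d hcd with ⟨q1, q2, q3, q4⟩ | ⟨q1, q2, q3, q4⟩ <;>
        rw [p3, p4, q3, q4] at heq
      · exact ⟨p1.trans q1.symm, p2.trans q2.symm⟩
      · exact absurd ⟨heq.1.symm, heq.2.symm⟩ q2
      · exact absurd heq p2
      · exact heq

lemma sub1 : A1.erase (u, v) ⊆ jn A1 A2 u v w := fun _ h =>
  Finset.mem_insert_of_mem (Finset.mem_union_left _ h)

lemma sub2 : A2.erase (v, w) ⊆ jn A1 A2 u v w := fun _ h =>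
  Finset.mem_insert_of_mem (Finset.mem_union_right _ h)

lemma reach_mono {A B : Finset (ℕ × ℕ)} (h : A ⊆ B) {x y : ℕ} (hr : ReflTransGen (Ar A) x y) :
    ReflTransGen (Ar B) x y := ReflTransGen.mono (fun _ _ h' => h h') _ _ hr

lemma str_join (J : Join V1 V2 A1 A2 u v w) (s1 : Str V1 A1) (s2 : Str V2 A2) :
    Str (V1 ∪ V2) (jn A1 A2 u v w) := by
  obtain ⟨hu1, hv1, hv2, hw2, huv, hwv, hu2, hw1⟩ := J.facts
  have huw : Ar (jn A1 A2 u v w) u w := Finset.mem_insert_self _ _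
  have h1 : ReflTransGen (Ar (jn A1 A2 u v w)) u v :=
    (reach_mono sub2 (reach_erase_end (s2 w hw2 v hv2))).head huw
  have h2 : ReflTransGen (Ar (jn A1 A2 u v w)) v w :=
    (reach_mono sub1 (reach_erase_start (s1 v hv1 u hu1))).tail huw
  have l1 : ∀ x y, ReflTransGen (Ar A1) x y → ReflTransGen (Ar (jn A1 A2 u v w)) x y := by
    intro x y h
    refine ReflTransGen.lift' (p := Ar (jn A1 A2 u v w)) id ?_ x y h
    intro a b hab
    by_cases hc : (a, b) = (u, v)
    · simp at hc; obtain ⟨rfl, rfl⟩ := hc; exact h1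
    · exact .single (sub1 (Finset.mem_erase.2 ⟨hc, hab⟩))
  have l2 : ∀ x y, ReflTransGen (Ar A2) x y → ReflTransGen (Ar (jn A1 A2 u v w)) x y := by
    intro x y h
    refine ReflTransGen.lift' (p := Ar (jn A1 A2 u v w)) id ?_ x y h
    intro a b hab
    by_cases hc : (a, b) = (v, w)
    · simp at hc; obtain ⟨rfl, rfl⟩ := hc; exact h2
    · exact .single (sub2 (Finset.mem_erase.2 ⟨hc, hab⟩))
  intro x hx y hy
  have hxv : ReflTransGen (Ar (jn A1 A2 u v w)) x v := by
    rcases Finset.mem_union.1 hx with hx | hx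
    · exact l1 _ _ (s1 x hx v hv1)
    · exact l2 _ _ (s2 x hx v hv2)
  have hvy : ReflTransGen (Ar (jn A1 A2 u v w)) v y := by
    rcases Finset.mem_union.1 hy with hy | hy
    · exact l1 _ _ (s1 v hv1 y hy)
    · exact l2 _ _ (s2 v hv2 y hy)
  exact hxv.trans hvy

lemma adv_symm {A : Finset (ℕ × ℕ)} {c x y : ℕ} (h : ReflTransGen (Adv A c) x y) :
    ReflTransGen (Adv A c) y x := by
  refine ReflTransGen.mono ?_ _ _ h.swap
  rintro a b ⟨h1, h2, h3⟩
  exact ⟨h1.symm, h3, h2⟩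

/-- Directed walks inside `W`, with `c ∉ W`, avoid `c`. -/
lemma adv_of_reach {W : Finset ℕ} {A B : Finset (ℕ × ℕ)} {c x y : ℕ} (hW : Wf W A) (hAB : A ⊆ B)
    (hc : c ∉ W) (h : ReflTransGen (Ar A) x y) : ReflTransGen (Adv B c) x y := by
  refine ReflTransGen.mono ?_ _ _ h
  intro a b hab
  have := hW _ hab
  exact ⟨Or.inl (hAB hab), fun h => hc (h ▸ this.1), fun h => hc (h ▸ this.2.1)⟩

/-- Transfer of undirected walks avoiding `c` when one arc is replaced by a walk. -/
lemma adv_lift {A B : Finset (ℕ × ℕ)} {c p q x y : ℕ} (hAB : A.erase (p, q) ⊆ B)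
    (hpq : p ≠ c → q ≠ c → ReflTransGen (Adv B c) p q) (h : ReflTransGen (Adv A c) x y) :
    ReflTransGen (Adv B c) x y := by
  refine ReflTransGen.lift' (p := Adv B c) id ?_ x y h
  rintro a b ⟨hab, hac, hbc⟩
  have key : ∀ a b, (a, b) ∈ A → a ≠ c → b ≠ c → ReflTransGen (Adv B c) a b := by
    intro a b hab hac hbc
    by_cases hc : (a, b) = (p, q)
    · simp at hc; obtain ⟨rfl, rfl⟩ := hc; exact hpq hac hbc
    · exact .single ⟨Or.inl (hAB (Finset.mem_erase.2 ⟨hc, hab⟩)), hac, hbc⟩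
  rcases hab with hab | hab
  · exact key a b hab hac hbc
  · exact adv_symm (key b a hab hbc hac)

lemma nocut_join (J : Join V1 V2 A1 A2 u v w) (s1 : Str V1 A1) (s2 : Str V2 A2)
    (n1 : NoCut V1 A1) (n2 : NoCut V2 A2) : NoCut (V1 ∪ V2) (jn A1 A2 u v w) := by
  obtain ⟨hu1, hv1, hv2, hw2, huv, hwv, hu2, hw1⟩ := J.facts
  have huw : (u, w) ∈ jn A1 A2 u v w := Finset.mem_insert_self _ _
  have wf1 : Wf V1 (A1.erase (u, v)) := fun a ha => J.wf1 a (Finset.mem_of_mem_erase ha)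
  have wf2 : Wf V2 (A2.erase (v, w)) := fun a ha => J.wf2 a (Finset.mem_of_mem_erase ha)
  intro c hc
  suffices hs : ∃ t, ∀ x ∈ V1 ∪ V2, x ≠ c → ReflTransGen (Adv (jn A1 A2 u v w) c) x t by
    obtain ⟨t, ht⟩ := hs
    intro x hx y hy hxc hyc
    exact (ht x hx hxc).trans (adv_symm (ht y hy hyc))
  by_cases hcv : c = v
  · subst hcv
    refine ⟨u, fun x hx hxc => ?_⟩
    rcases Finset.mem_union.1 hx with hx | hx
    · exact adv_lift sub1 (fun _ h => absurd rfl h) (n1 c hv1 x hx u hu1 hxc huv)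
    · exact (adv_lift sub2 (fun h _ => absurd rfl h) (n2 c hv2 x hx w hw2 hxc hwv)).tail
        ⟨Or.inr huw, hwv, huv⟩
  · refine ⟨v, fun x hx hxc => ?_⟩
    have hvc : v ≠ c := fun h => hcv h.symm
    rcases Finset.mem_union.1 hc with hc | hc
    · have hc2 : c ∉ V2 := fun h => hcv (J.inter c hc h)
      have d2 : ∀ z ∈ V2, ReflTransGen (Adv (jn A1 A2 u v w) c) z v := fun z hz =>
        adv_of_reach wf2 sub2 hc2 (reach_erase_end (s2 z hz v hv2))
      rcases Finset.mem_union.1 hx with hx | hx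
      · refine adv_lift sub1 (fun h1 _ => ?_) (n1 c hc x hx v hv1 hxc hvc)
        exact (d2 w hw2).head ⟨Or.inl huw, h1, fun h => hc2 (h ▸ hw2)⟩
      · exact d2 x hx
    · have hc1 : c ∉ V1 := fun h => hcv (J.inter c h hc)
      have d1 : ∀ z ∈ V1, ReflTransGen (Adv (jn A1 A2 u v w) c) v z := fun z hz =>
        adv_of_reach wf1 sub1 hc1 (reach_erase_start (s1 v hv1 z hz))
      rcases Finset.mem_union.1 hx with hx | hx
      · exact adv_symm (d1 x hx)
      · refine adv_lift sub2 (fun _ h1 => ?_) (n2 c hc x hx v hv2 hxc hvc)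
        exact (d1 u hu1).tail ⟨Or.inl huw, fun h => hc1 (h ▸ hu1), h1⟩

lemma ex_join_iff (J : Join V1 V2 A1 A2 u v w) {k : ℕ} (hk : 1 ≤ k) :
    Ex k (V1 ∪ V2) (jn A1 A2 u v w) ↔ Ex k V1 A1 ∧ Ex k V2 A2 := by
  refine ⟨ex_of_join J hk, ?_⟩
  rintro ⟨⟨a1, a2, a3, a4⟩, b1, b2, b3, b4⟩
  exact ⟨nocut_join J a2 b2 a1 b1, str_join J a2 b2, not_col_join a3 b3, sep_join J a4 b4⟩

/-- Renaming by a permutation. -/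
def mapA (e : ℕ ≃ ℕ) (A : Finset (ℕ × ℕ)) : Finset (ℕ × ℕ) := A.image fun a => (e a.1, e a.2)

lemma mem_mapA {e : ℕ ≃ ℕ} {A : Finset (ℕ × ℕ)} {a b : ℕ} :
    (a, b) ∈ mapA e A ↔ (e.symm a, e.symm b) ∈ A := by
  simp only [mapA, Finset.mem_image, Prod.mk.injEq, Prod.exists]
  constructor
  · rintro ⟨c, d, h, rfl, rfl⟩; simpa using h
  · intro h; exact ⟨_, _, h, by simp, by simp⟩

lemma mem_mapV {e : ℕ ≃ ℕ} {V : Finset ℕ} {a : ℕ} : a ∈ V.image e ↔ e.symm a ∈ V := by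
  simp only [Finset.mem_image]
  constructor
  · rintro ⟨c, h, rfl⟩; simpa using h
  · intro h; exact ⟨_, h, by simp⟩

lemma Ex.map {k : ℕ} {V : Finset ℕ} {A : Finset (ℕ × ℕ)} (h : Ex k V A) (e : ℕ ≃ ℕ) :
    Ex k (V.image e) (mapA e A) := by
  obtain ⟨h1, h2, h3, h4⟩ := h
  refine ⟨?_, ?_, ?_, ?_⟩
  · intro c hc x hx y hy hxc hyc
    rw [mem_mapV] at hc hx hy
    have := h1 _ hc _ hx _ hy (by simpa using hxc) (by simpa using hyc)
    have h5 := ReflTransGen.lift' (p := Adv (mapA e A) c) e (by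
      rintro a b ⟨h, h', h''⟩
      refine .single ⟨?_, ?_, ?_⟩
      · rw [mem_mapA, mem_mapA]; simpa using h
      · intro hh; exact h' (by rw [← hh]; simp)
      · intro hh; exact h'' (by rw [← hh]; simp)) _ _ this
    simpa [Function.onFun] using h5
  · intro x hx y hy
    rw [mem_mapV] at hx hy
    have h5 := ReflTransGen.lift' (p := Ar (mapA e A)) e (by
      intro a b h
      refine .single ?_
      exact mem_mapA.2 (by have h' : (a, b) ∈ A := h; simpa using h')) _ _ (h2 _ hx _ hy)
    simpa [Function.onFun] using h5
  · rintro ⟨φ, f, hf⟩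
    refine h3 ⟨fun z => φ (e z), fun z => f (e z), ?_⟩
    rintro ⟨a, b⟩ hab hc
    exact hf (e a, e b) (mem_mapA.2 (by simpa using hab)) hc
  · intro x hx y hy hxy
    rw [mem_mapV] at hx hy
    obtain ⟨X, hxX, hyX, hX⟩ := h4 _ hx _ hy (by simpa using hxy)
    refine ⟨X.image e, mem_mapV.2 hxX, fun h => hyX (mem_mapV.1 h), le_trans ?_ hX⟩
    apply Finset.card_le_card_of_injOn (fun a => (e.symm a.1, e.symm a.2))
    · rintro ⟨a, b⟩ hab
      have := mem_cut.1 hab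
      rw [mem_mapA, mem_mapV, mem_mapV] at this
      exact mem_cut.2 this
    · rintro ⟨a, b⟩ _ ⟨c, d⟩ _ h
      simpa using h

lemma ex_map_iff {k : ℕ} {V : Finset ℕ} {A : Finset (ℕ × ℕ)} (e : ℕ ≃ ℕ) :
    Ex k (V.image e) (mapA e A) ↔ Ex k V A := by
  refine ⟨fun h => ?_, fun h => h.map e⟩
  have h1 := h.map e.symm
  have hA : mapA e.symm (mapA e A) = A := by
    ext ⟨a, b⟩
    rw [mem_mapA, mem_mapA]; simp
  have hV : (V.image e).image e.symm = V := by
    ext a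
    rw [mem_mapV, mem_mapV]; simp
  rwa [hA, hV] at h1

lemma Wf.map {V : Finset ℕ} {A : Finset (ℕ × ℕ)} (h : Wf V A) (e : ℕ ≃ ℕ) :
    Wf (V.image e) (mapA e A) := by
  rintro ⟨a, b⟩ hab
  have := h _ (mem_mapA.1 hab)
  exact ⟨mem_mapV.2 this.1, mem_mapV.2 this.2.1, fun hh => this.2.2 (congrArg e.symm hh)⟩

theorem main (k : ℕ) (hk : 1 ≤ k) (D D1 D2 : Dgraph)
    (hjoin : Dgraph.IsDirHajosJoin D D1 D2) :
    Dgraph.Extremal k D ↔ (Dgraph.Extremal k D1 ∧ Dgraph.Extremal k D2) := by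
  obtain ⟨u, v1, v2, w, v, wf1, wf2, hdis, huv, hvw, hv, hV, hA⟩ := hjoin
  have hdis' : ∀ z, z ∈ D1.verts → z ∉ D2.verts := fun z h => Finset.disjoint_left.1 hdis h
  have hu := wf1 _ huv
  have hw := wf2 _ hvw
  simp only at hu hw
  simp only [Finset.mem_union, Finset.mem_erase, not_or, not_and] at hv
  set e1 := Equiv.swap v1 v with he1
  set e2 := Equiv.swap v2 v with he2
  have s1 : ∀ z ∈ D1.verts, e1 z = Dgraph.ren v2 v (Dgraph.ren v1 v z) := by
    intro z hz
    have hz2 : z ≠ v2 := fun h => hdis' z hz (h ▸ hw.1)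
    by_cases h : z = v1
    · subst h
      simp only [he1, Dgraph.ren, Equiv.swap_apply_left, if_true]
      split_ifs <;> rfl
    · have hzv : z ≠ v := by
        rintro rfl
        exact hv.1 h hz
      rw [he1, Equiv.swap_apply_of_ne_of_ne h hzv]
      simp [Dgraph.ren, h, hz2]
  have s2 : ∀ z ∈ D2.verts, e2 z = Dgraph.ren v2 v (Dgraph.ren v1 v z) := by
    intro z hz
    have hz2 : z ≠ v1 := fun h => hdis' z (h ▸ hu.2.1) hz
    by_cases h : z = v2
    · subst h
      simp [he2, Dgraph.ren, hz2]
    · have hzv : z ≠ v := by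
        rintro rfl
        exact hv.2 h hz
      rw [he2, Equiv.swap_apply_of_ne_of_ne h hzv]
      simp [Dgraph.ren, h, hz2]
  have ev1 : e1 v1 = v := by simp [he1]
  have ev2 : e2 v2 = v := by simp [he2]
  have f1 : ∀ z ∈ D1.verts, z ≠ v1 → e1 z = z := by
    intro z hz h
    exact Equiv.swap_apply_of_ne_of_ne h (by rintro rfl; exact hv.1 h hz)
  have f2 : ∀ z ∈ D2.verts, z ≠ v2 → e2 z = z := by
    intro z hz h
    exact Equiv.swap_apply_of_ne_of_ne h (by rintro rfl; exact hv.2 h hz)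
  have eu : e1 u = u := f1 u hu.1 hu.2.2
  have ew : e2 w = w := f2 w hw.2.1 (fun h => hw.2.2 h.symm)
  have J : Join (D1.verts.image e1) (D2.verts.image e2) (mapA e1 D1.arcs) (mapA e2 D2.arcs) u v w := by
    refine ⟨Wf.map wf1 e1, Wf.map wf2 e2, ?_, ?_, ?_⟩
    · intro z h1 h2
      obtain ⟨a, ha, rfl⟩ := Finset.mem_image.1 h1
      obtain ⟨b, hb, hab⟩ := Finset.mem_image.1 h2
      by_cases ha1 : a = v1
      · rw [ha1, ev1]
      · by_cases hb1 : b = v2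
        · rw [← hab, hb1, ev2]
        · rw [f1 a ha ha1, f2 b hb hb1] at hab
          exact absurd (hab ▸ hb) (hdis' a ha)
    · exact Finset.mem_image.2 ⟨_, huv, by simp [eu, ev1]⟩
    · exact Finset.mem_image.2 ⟨_, hvw, by simp [ew, ev2]⟩
  have img1 : D1.verts.image e1 = insert v (D1.verts.erase v1) := by
    ext z
    simp only [Finset.mem_image, Finset.mem_insert, Finset.mem_erase]
    constructor
    · rintro ⟨a, ha, rfl⟩
      by_cases h : a = v1
      · left; rw [h, ev1]
      · right; rw [f1 a ha h]; exact ⟨h, ha⟩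
    · rintro (rfl | ⟨h, hz⟩)
      · exact ⟨v1, hu.2.1, ev1⟩
      · exact ⟨z, hz, f1 z hz h⟩
  have img2 : D2.verts.image e2 = insert v (D2.verts.erase v2) := by
    ext z
    simp only [Finset.mem_image, Finset.mem_insert, Finset.mem_erase]
    constructor
    · rintro ⟨a, ha, rfl⟩
      by_cases h : a = v2
      · left; rw [h, ev2]
      · right; rw [f2 a ha h]; exact ⟨h, ha⟩
    · rintro (rfl | ⟨h, hz⟩)
      · exact ⟨v2, hw.1, ev2⟩
      · exact ⟨z, hz, f2 z hz h⟩
  have hV' : D.verts = D1.verts.image e1 ∪ D2.verts.image e2 := by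
    rw [hV, img1, img2]
    ext z
    simp only [Finset.mem_insert, Finset.mem_union]
    tauto
  have er1 : (mapA e1 D1.arcs).erase (u, v) = (D1.arcs.erase (u, v1)).image
      (fun a => Dgraph.renArc v2 v (Dgraph.renArc v1 v a)) := by
    have : (u, v) = (fun a : ℕ × ℕ => (e1 a.1, e1 a.2)) (u, v1) := by simp [eu, ev1]
    rw [this, mapA, ← Finset.image_erase]
    · apply Finset.image_congr
      intro a ha
      have h := wf1 a (Finset.mem_of_mem_erase ha)
      simp only [Dgraph.renArc, s1 _ h.1, s1 _ h.2.1]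
    · rintro ⟨a, b⟩ ⟨c, d⟩ h
      simpa using h
  have er2 : (mapA e2 D2.arcs).erase (v, w) = (D2.arcs.erase (v2, w)).image
      (fun a => Dgraph.renArc v2 v (Dgraph.renArc v1 v a)) := by
    have : (v, w) = (fun a : ℕ × ℕ => (e2 a.1, e2 a.2)) (v2, w) := by simp [ew, ev2]
    rw [this, mapA, ← Finset.image_erase]
    · apply Finset.image_congr
      intro a ha
      have h := wf2 a (Finset.mem_of_mem_erase ha)
      simp only [Dgraph.renArc, s2 _ h.1, s2 _ h.2.1]
    · rintro ⟨a, b⟩ ⟨c, d⟩ h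
      simpa using h
  have hA' : D.arcs = jn (mapA e1 D1.arcs) (mapA e2 D2.arcs) u v w := by
    rw [hA, jn, er1, er2, Finset.image_union]
  have hD : D.WF := by
    have := J.wf
    rw [← hV', ← hA'] at this
    exact this
  rw [extremal_iff hD hk, extremal_iff wf1 hk, extremal_iff wf2 hk, hV', hA', ex_join_iff J hk,
    ex_map_iff, ex_map_iff]

end HJ
/-- Lemma 5.3: a directed Hajós join of two digraphs is
k-extremal if and only if both of them are. -/
theorem statement_9 (k : ℕ) (hk : 1 ≤ k) (D D1 D2 : Dgraph)
    (hjoin : IsDirHajosJoin D D1 D2) :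
    Extremal k D ↔ (Extremal k D1 ∧ Extremal k D2) := by
  exact HJ.main k hk D D1 D2 hjoin
end

section
/- Let k ≥ 1 and let D be a k-extremal digraph with an arc uw ∈ A(D) such that D − uw has a cutvertex v. Then D is a directed Hajós join of two digraphs D1 and D2 with respect to (uv, vw). -/
open Dgraph


namespace S10

open Relation

lemma tmono {R S : ℕ → ℕ → Prop} (h : ∀ a b, R a b → S a b) {x y : ℕ} (hxy : TransGen R x y) :
    TransGen S x y := by
  induction hxy with
  | single hab => exact .single (h _ _ hab)
  | tail _ hab ih => exact .tail ih (h _ _ hab)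

lemma rtmono {R S : ℕ → ℕ → Prop} (h : ∀ a b, R a b → S a b) {x y : ℕ}
    (hxy : ReflTransGen R x y) : ReflTransGen S x y := by
  induction hxy with
  | refl => exact .refl
  | tail _ hab ih => exact .tail ih (h _ _ hab)

/-! ### Menger theorem for arcs -/

/-- Number of arcs leaving `X`. -/
def cut (A : Finset (ℕ × ℕ)) (X : Finset ℕ) : ℕ :=
  (A.filter fun a => a.1 ∈ X ∧ a.2 ∉ X).card

lemma cut_submod (A : Finset (ℕ × ℕ)) (X Y : Finset ℕ) :
    cut A (X ∩ Y) + cut A (X ∪ Y) ≤ cut A X + cut A Y := by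
  unfold cut
  simp only [Finset.card_filter]
  rw [← Finset.sum_add_distrib, ← Finset.sum_add_distrib]
  apply Finset.sum_le_sum
  rintro ⟨a, b⟩ _
  simp only [Finset.mem_inter, Finset.mem_union]
  by_cases h1 : a ∈ X <;> by_cases h2 : a ∈ Y <;> by_cases h3 : b ∈ X <;> by_cases h4 : b ∈ Y <;>
    simp [h1, h2, h3, h4]

lemma cut_mono {A B : Finset (ℕ × ℕ)} (h : A ⊆ B) (X : Finset ℕ) : cut A X ≤ cut B X :=
  Finset.card_le_card (Finset.filter_subset_filter _ h)

lemma cut_erase_le (A : Finset (ℕ × ℕ)) (a : ℕ × ℕ) (X : Finset ℕ) :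
    cut A X ≤ cut (A.erase a) X + 1 := by
  unfold cut
  rw [Finset.filter_erase]
  have := Finset.pred_card_le_card_erase
    (s := A.filter fun a => a.1 ∈ X ∧ a.2 ∉ X) (a := a)
  omega

lemma cut_erase_eq (A : Finset (ℕ × ℕ)) (a : ℕ × ℕ) (X : Finset ℕ)
    (h : ¬ (a.1 ∈ X ∧ a.2 ∉ X)) :
    cut (A.erase a) X = cut A X := by
  unfold cut
  rw [Finset.filter_erase, Finset.erase_eq_of_notMem]
  simp only [Finset.mem_filter]
  tauto

lemma cut_sdiff {A B : Finset (ℕ × ℕ)} (h : A ⊆ B) (X : Finset ℕ) {a : ℕ × ℕ}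
    (ha : a ∈ B) (ha' : a ∉ A) (h1 : a.1 ∈ X) (h2 : a.2 ∉ X) : cut A X + 1 ≤ cut B X := by
  unfold cut
  apply Finset.card_lt_card
  rw [Finset.ssubset_iff_of_subset (Finset.filter_subset_filter _ h)]
  exact ⟨a, by simp [ha, h1, h2], by simp [ha']⟩

lemma trail (x y n : ℕ) (hn : 1 ≤ n) (hxy : x ≠ y) (V : Finset ℕ) (A : Finset (ℕ × ℕ))
    (hV : ∀ a ∈ A, a.1 ∈ V ∧ a.2 ∈ V)
    (hmin : ∀ B ⊆ A, (∀ X ⊆ V, x ∈ X → y ∉ X → n ≤ cut B X) → B = A) :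
    ∀ (m : ℕ) (A' : Finset (ℕ × ℕ)) (z : ℕ), A'.card = m → A' ⊆ A → z ∈ V →
      (z = x ∨ A' ≠ A) →
      (∀ X ⊆ V, x ∈ X → y ∉ X → n ≤ cut A' X + if z ∈ X then 0 else 1) →
      ∃ A'' ⊆ A', (∀ X ⊆ V, x ∈ X → y ∉ X → n ≤ cut A'' X + 1) ∧
        ReflTransGen (fun a b => (a, b) ∈ A' \ A'') z y := by
  intro m
  induction m with
  | zero =>
    intro A' z hc hA hz hzx hcut
    by_cases hzy : z = y
    · refine ⟨A', subset_rfl, ?_, hzy ▸ .refl⟩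
      intro X h1 h2 h3
      have := hcut X h1 h2 h3
      split_ifs at this <;> omega
    · exfalso
      have hA0 : A' = ∅ := Finset.card_eq_zero.mp hc
      have hxz : x ∈ V ∨ x ∉ V := em _
      rcases hxz with hx | hx
      · have := hcut {x, z} (by intro a; simp; rintro (rfl | rfl) <;> assumption) (by simp)
          (by simp; exact ⟨fun h => hxy h.symm, fun h => hzy h.symm⟩)
        simp [hA0, cut] at this
        omega
      · have h1 : A' = A := hmin A' hA (by intro X h1 h2; exact absurd (h1 h2) hx)
        rcases hzx with h | h
        · exact hx (h ▸ hz)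
        · exact h h1
  | succ m ih =>
    intro A' z hc hA hz hzx hcut
    by_cases hzy : z = y
    · refine ⟨A', subset_rfl, ?_, hzy ▸ .refl⟩
      intro X h1 h2 h3
      have := hcut X h1 h2 h3
      split_ifs at this <;> omega
    -- find the next arc
    have key : ∃ z', (z, z') ∈ A' ∧ ∀ X ⊆ V, x ∈ X → y ∉ X → z ∉ X → z' ∈ X → n ≤ cut A' X := by
      let T := V.powerset.filter fun X => x ∈ X ∧ y ∉ X ∧ z ∉ X ∧ cut A' X < n
      by_cases hT : T.Nonempty
      · obtain ⟨M, hM, hMmax⟩ := Finset.exists_max_image T Finset.card hT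
        have hM' := hM
        simp only [T, Finset.mem_filter, Finset.mem_powerset] at hM
        obtain ⟨hMV, hxM, hyM, hzM, hMc⟩ := hM
        have hsub : ∀ X ∈ T, X ⊆ M := by
          intro X hX
          have hX' := hX
          simp only [T, Finset.mem_filter, Finset.mem_powerset] at hX
          obtain ⟨hXV, hxX, hyX, hzX, hXc⟩ := hX
          have hs := cut_submod A' X M
          have hi := hcut (X ∩ M) (Finset.inter_subset_left.trans hXV) (by simp [*]) (by simp [*])
          rw [if_neg (by simp [*])] at hi
          have hU : X ∪ M ∈ T := by
            simp only [T, Finset.mem_filter, Finset.mem_powerset]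
            refine ⟨Finset.union_subset hXV hMV, by simp [*], by simp [*], by simp [*], by omega⟩
          have := hMmax _ hU
          have he := Finset.eq_of_subset_of_card_le (Finset.subset_union_right : M ⊆ X ∪ M) this
          rw [he]; exact Finset.subset_union_left
        have : ∃ z', (z, z') ∈ A' ∧ z' ∉ M := by
          by_contra hcon
          push Not at hcon
          have h1 := hcut (insert z M) (Finset.insert_subset hz hMV) (by simp [*])
            (by simp [hyM]; exact fun h => hzy h.symm)
          rw [if_pos (by simp)] at h1
          have h2 : cut A' (insert z M) ≤ cut A' M := by
            apply Finset.card_le_card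
            rintro ⟨a, b⟩
            simp only [Finset.mem_filter, Finset.mem_insert, not_or]
            rintro ⟨hab, (rfl | ha), hb1, hb2⟩
            · exact absurd (hcon b hab) hb2
            · exact ⟨hab, ha, hb2⟩
          omega
        obtain ⟨z', hz', hzM'⟩ := this
        refine ⟨z', hz', ?_⟩
        intro X h1 h2 h3 h4 h5
        by_contra h6
        have : X ∈ T := by
          simp only [T, Finset.mem_filter, Finset.mem_powerset]
          exact ⟨h1, h2, h3, h4, by omega⟩
        exact hzM' (hsub X this h5)
      · have hall : ∀ X ⊆ V, x ∈ X → y ∉ X → n ≤ cut A' X := by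
          intro X h1 h2 h3
          have h4 := hcut X h1 h2 h3
          split_ifs at h4 with h5
          · exact h4
          · by_contra h6
            exact hT ⟨X, by
              simp only [T, Finset.mem_filter, Finset.mem_powerset]
              exact ⟨h1, h2, h3, h5, by omega⟩⟩
        have hAA := hmin A' hA hall
        have hzx' : z = x := by tauto
        subst hzx'
        have h1 := hall {z} (by simpa using hz) (by simp) (by simpa using fun h => hxy h.symm)
        have h2 : 0 < cut A' {z} := by omega
        obtain ⟨⟨a, b⟩, hab⟩ := Finset.card_pos.mp h2
        simp only [Finset.mem_filter, Finset.mem_singleton] at hab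
        obtain ⟨hab, rfl, hb⟩ := hab
        exact ⟨b, hab, fun X h1 h2 h3 _ _ => hall X h1 h2 h3⟩
    obtain ⟨z', hz', hX⟩ := key
    have hzz : (A'.erase (z, z')).card = m := by
      rw [Finset.card_erase_of_mem hz', hc]; rfl
    obtain ⟨A'', hs, h1, h2⟩ := ih (A'.erase (z, z')) z' hzz ((Finset.erase_subset _ _).trans hA)
      (hV _ (hA hz')).2 (.inr (by
        intro h
        have := hA hz'
        rw [← h] at this
        exact Finset.notMem_erase _ _ this)) (by
        intro X g1 g2 g3
        have g4 := hcut X g1 g2 g3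
        by_cases g5 : z ∈ X <;> by_cases g6 : z' ∈ X
        · rw [cut_erase_eq _ _ _ (by simp [g6])]; simpa [g5, g6] using g4
        · have := cut_erase_le A' (z, z') X
          simp only [g5, g6, if_true, if_false] at g4 ⊢
          omega
        · rw [cut_erase_eq _ _ _ (by simp [g5])]
          have := hX X g1 g2 g3 g5 g6
          omega
        · rw [cut_erase_eq _ _ _ (by simp [g5])]; simpa [g5, g6] using g4)
    refine ⟨A'', hs.trans (Finset.erase_subset _ _), h1, ?_⟩
    refine ReflTransGen.head (b := z') ?_ (rtmono ?_ h2)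
    · simp only [Finset.mem_sdiff]
      refine ⟨hz', fun h => ?_⟩
      exact Finset.notMem_erase _ _ (hs h)
    · intro a b hab
      simp only [Finset.mem_sdiff] at hab ⊢
      exact ⟨Finset.mem_of_mem_erase hab.1, hab.2⟩

/-- Directed path within a set of arcs, vertices in `V`. -/
def PathIn (V : Finset ℕ) (A : Finset (ℕ × ℕ)) (p : List ℕ) (x y : ℕ) : Prop :=
  p.Nodup ∧ p.head? = some x ∧ p.getLast? = some y ∧ (∀ z ∈ p, z ∈ V) ∧
    p.IsChain (fun a b => (a, b) ∈ A)

lemma exists_path (V : Finset ℕ) (A : Finset (ℕ × ℕ)) (hV : ∀ a ∈ A, a.1 ∈ V ∧ a.2 ∈ V)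
    (x y : ℕ) (hy : y ∈ V) (h : ReflTransGen (fun a b => (a, b) ∈ A) x y) :
    ∃ p, PathIn V A p x y := by
  induction h using ReflTransGen.head_induction_on with
  | refl => exact ⟨[y], by simp [PathIn, hy]⟩
  | head hab _ ih =>
    rename_i a b _
    obtain ⟨p, h1, h2, h3, h4, h5⟩ := ih
    by_cases ha : a ∈ p
    · obtain ⟨s, t, rfl⟩ := List.append_of_mem ha
      refine ⟨a :: t, ?_, by simp, ?_, ?_, ?_⟩
      · exact (List.nodup_append.mp h1).2.1
      · rw [List.getLast?_append_of_ne_nil _ (by simp)] at h3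
        exact h3
      · intro z hz; exact h4 z (by simp_all)
      · exact (List.isChain_append.mp h5).2.1
    · cases p with
      | nil => simp at h2
      | cons c t =>
        simp only [List.head?_cons, Option.some.injEq] at h2
        subst h2
        refine ⟨a :: c :: t, ?_, by simp, ?_, ?_, ?_⟩
        · exact List.nodup_cons.mpr ⟨ha, h1⟩
        · simpa [List.getLast?_cons_cons] using h3
        · intro z hz
          rcases List.mem_cons.mp hz with rfl | hz
          · exact (hV _ hab).1
          · exact h4 z hz
        · exact List.isChain_cons_cons.mpr ⟨hab, h5⟩

lemma arcsOf_subset (A : Finset (ℕ × ℕ)) (p : List ℕ) (h : p.IsChain (fun a b => (a, b) ∈ A)) :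
    arcsOf p ⊆ A := by
  induction p with
  | nil => simp [arcsOf]
  | cons a t ih =>
    cases t with
    | nil => simp [arcsOf]
    | cons b t =>
      obtain ⟨h1, h2⟩ := List.isChain_cons_cons.mp h
      have := ih h2
      simp only [arcsOf, List.tail_cons, List.zip_cons_cons, List.toFinset_cons] at this ⊢
      exact Finset.insert_subset h1 this

lemma arcsOf_nonempty (V : Finset ℕ) (A : Finset (ℕ × ℕ)) (p : List ℕ) (x y : ℕ) (hxy : x ≠ y)
    (h : PathIn V A p x y) : (arcsOf p).Nonempty := by
  obtain ⟨h1, h2, h3, h4, h5⟩ := h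
  match p with
  | [] => simp at h2
  | [a] => simp at h2 h3; exact absurd (h2.symm.trans h3) hxy
  | a :: b :: t => exact ⟨(a, b), by simp [arcsOf]⟩

lemma menger (x y : ℕ) (hxy : x ≠ y) (V : Finset ℕ) (hx : x ∈ V) (hy : y ∈ V) :
    ∀ (n : ℕ) (A : Finset (ℕ × ℕ)), (∀ a ∈ A, a.1 ∈ V ∧ a.2 ∈ V) →
      (∀ X ⊆ V, x ∈ X → y ∉ X → n ≤ cut A X) →
      ∃ P : Fin n → List ℕ, (∀ i, PathIn V A (P i) x y) ∧
        Pairwise fun i j => Disjoint (arcsOf (P i)) (arcsOf (P j)) := by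
  intro n
  induction n with
  | zero => intro A _ _; exact ⟨fun i => i.elim0, fun i => i.elim0, fun i => i.elim0⟩
  | succ n ih =>
    intro A hV hcut
    let T := A.powerset.filter fun B => ∀ X ∈ V.powerset, x ∈ X → y ∉ X → n + 1 ≤ cut B X
    have hAT : A ∈ T := by
      simp only [T, Finset.mem_filter, Finset.mem_powerset]
      exact ⟨subset_rfl, hcut⟩
    obtain ⟨B, hB, hBmin⟩ := Finset.exists_min_image T Finset.card ⟨A, hAT⟩
    simp only [T, Finset.mem_filter, Finset.mem_powerset] at hB
    obtain ⟨hBA, hBcut⟩ := hB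
    obtain ⟨A'', hs, h1, h2⟩ := trail x y (n + 1) (by omega) hxy V B (fun a ha => hV a (hBA ha))
      (by
        intro C hC hcC
        apply Finset.eq_of_subset_of_card_le hC
        apply hBmin
        simp only [T, Finset.mem_filter, Finset.mem_powerset]
        exact ⟨hC.trans hBA, hcC⟩)
      B.card B x rfl subset_rfl hx (.inl rfl)
      (fun X g1 g2 g3 => (hBcut X g1 g2 g3).trans (Nat.le_add_right _ _))
    obtain ⟨p, hp⟩ := exists_path V (B \ A'')
      (fun a ha => hV a (hBA (Finset.mem_sdiff.mp ha).1)) x y hy h2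
    obtain ⟨P, hP, hPd⟩ := ih A'' (fun a ha => hV a (hBA (hs ha)))
      (fun X g1 g2 g3 => by have := h1 X g1 g2 g3; omega)
    have hd : ∀ i, Disjoint (arcsOf p) (arcsOf (P i)) := fun i =>
      Finset.disjoint_of_subset_left (arcsOf_subset _ _ hp.2.2.2.2)
        (Finset.disjoint_of_subset_right (arcsOf_subset _ _ (hP i).2.2.2.2)
          Finset.sdiff_disjoint)
    refine ⟨Fin.cons p P, ?_, ?_⟩
    · intro i
      refine Fin.cases ?_ (fun i => ?_) i
      · obtain ⟨g1, g2, g3, g4, g5⟩ := hp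
        exact ⟨g1, g2, g3, g4, g5.imp (fun a b hab => hBA (Finset.mem_sdiff.mp hab).1)⟩
      · obtain ⟨g1, g2, g3, g4, g5⟩ := hP i
        exact ⟨g1, g2, g3, g4, g5.imp (fun a b hab => hBA (hs hab))⟩
    · intro i j
      refine Fin.cases ?_ (fun i => ?_) i <;> refine Fin.cases ?_ (fun j => ?_) j
      · intro h; exact absurd rfl h
      · intro _; exact hd j
      · intro _; exact (hd i).symm
      · intro h; exact hPd (fun h' => h (congrArg Fin.succ (Fin.ext (Fin.mk.inj h'))))

lemma le_lam (D : Dgraph) (hWF : D.WF) (x y n : ℕ) (hxy : x ≠ y) (hx : x ∈ D.verts)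
    (hy : y ∈ D.verts) (hcut : ∀ X ⊆ D.verts, x ∈ X → y ∉ X → n ≤ cut D.arcs X) :
    n ≤ D.lam := by
  obtain ⟨P, hP, hPd⟩ := menger x y hxy D.verts hx hy n D.arcs
    (fun a ha => ⟨(hWF a ha).1, (hWF a ha).2.1⟩) hcut
  have h1 : n ≤ D.locLam x y := by
    apply le_csSup
    · refine ⟨D.arcs.card, ?_⟩
      rintro m ⟨Q, hQ, hQd⟩
      have hne : ∀ i, (arcsOf (Q i)).Nonempty := fun i =>
        arcsOf_nonempty D.verts D.arcs (Q i) x y hxy (hQ i)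
      choose f hf using hne
      have hfi : Function.Injective f := by
        intro i j hij
        by_contra hne
        exact Finset.disjoint_left.mp (hQd hne) (hf i) (hij ▸ hf j)
      have := Finset.card_le_card_of_injOn (s := Finset.univ) (t := D.arcs) f
        (fun i _ => arcsOf_subset D.arcs _ (hQ i).2.2.2.2 (hf i)) hfi.injOn
      simpa using this
    · exact ⟨P, hP, hPd⟩
  refine h1.trans (le_csSup ?_ ⟨x, hx, y, hy, hxy, rfl⟩)
  apply Set.Finite.bddAbove
  apply ((D.verts ×ˢ D.verts).image fun p => D.locLam p.1 p.2).finite_toSet.subset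
  rintro m ⟨a, ha, b, hb, _, rfl⟩
  simp only [Finset.coe_image, Set.mem_image, Finset.mem_coe, Finset.mem_product]
  exact ⟨(a, b), ⟨ha, hb⟩, rfl⟩

/-! ### Colourings -/

/-- No monochromatic closed walk. -/
def Good {k : ℕ} (E : ℕ → ℕ → Prop) (φ : ℕ → Fin k) : Prop :=
  ∀ z, ¬ TransGen (fun a b => E a b ∧ φ a = φ b) z z

lemma Good.mono {k : ℕ} {E E' : ℕ → ℕ → Prop} {φ : ℕ → Fin k} (h : Good E φ)
    (hE : ∀ a b, E' a b → E a b) : Good E' φ := fun z hz =>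
  h z (tmono (fun a b hab => ⟨hE a b hab.1, hab.2⟩) hz)

lemma Good.swap {k : ℕ} {E : ℕ → ℕ → Prop} {φ : ℕ → Fin k} (h : Good E φ) :
    Good (fun a b => E b a) φ := fun z hz => by
  apply h z
  rw [← transGen_swap]
  exact tmono (fun a b hab => ⟨hab.1, hab.2.symm⟩) hz

lemma Good.shift {m : ℕ} {E : ℕ → ℕ → Prop} {φ : ℕ → Fin (m + 1)} (h : Good E φ)
    (s : Fin (m + 1)) : Good E (fun a => φ a + s) := fun z hz =>
  h z (tmono (fun a b hab => ⟨hab.1, add_right_cancel hab.2⟩) hz)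

lemma reach_of_chain (E : ℕ → ℕ → Prop) (p : List ℕ) (x y : ℕ) (hp : p.IsChain E)
    (h1 : p.head? = some x) (h2 : p.getLast? = some y) : ReflTransGen E x y := by
  induction p generalizing x with
  | nil => simp at h1
  | cons a t ih =>
    simp only [List.head?_cons, Option.some.injEq] at h1
    subst h1
    cases t with
    | nil => simp at h2; subst h2; exact .refl
    | cons b t =>
      obtain ⟨g1, g2⟩ := List.isChain_cons_cons.mp hp
      exact .head g1 (ih b g2 (by simp) (by simpa [List.getLast?_cons_cons] using h2))

lemma Good.isDicolouring {k : ℕ} {D : Dgraph} {φ : ℕ → Fin k}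
    (h : Good (fun a b => (a, b) ∈ D.arcs) φ) : D.IsDicolouring k φ := by
  rintro p ⟨h1, h2, h3, h4, h5⟩ ⟨c, hc⟩
  have hne : p ≠ [] := by rintro rfl; simp at h1
  have hh := List.head?_eq_some_head hne
  have hl := List.getLast?_eq_some_getLast hne
  have h6 := h5 _ _ hl hh
  have h7 : p.IsChain (fun a b => (a, b) ∈ D.arcs ∧ φ a = φ b) := by
    clear hh hl h6 h5 h3 h2 h1 hne
    replace h4 : p.IsChain (fun a b => (a, b) ∈ D.arcs) := h4
    induction p with
    | nil => simp
    | cons a t ih =>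
      cases t with
      | nil => simp
      | cons b t =>
        obtain ⟨g1, g2⟩ := List.isChain_cons_cons.mp h4
        refine List.isChain_cons_cons.mpr ⟨⟨g1, ?_⟩, ih ?_ g2⟩
        · rw [hc a (by simp), hc b (by simp)]
        · intro x hx; exact hc x (List.mem_cons_of_mem _ hx)
  have h8 := reach_of_chain _ p _ _ h7 hh hl
  refine h (p.head hne) (TransGen.tail' h8 ⟨h6, ?_⟩)
  rw [hc _ (List.getLast_mem hne), hc _ (List.head_mem hne)]

/-- If no arc leaves `X`, every closed walk stays inside `X` or outside `X`. -/
lemma noleave (R : ℕ → ℕ → Prop) (X : Set ℕ) (h : ∀ a b, R a b → a ∈ X → b ∈ X) (z : ℕ)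
    (hz : TransGen R z z) :
    TransGen (fun a b => R a b ∧ a ∈ X ∧ b ∈ X) z z ∨
      TransGen (fun a b => R a b ∧ a ∉ X ∧ b ∉ X) z z := by
  by_cases hzX : z ∈ X
  · left
    have : ∀ y, TransGen R z y → y ∈ X ∧ TransGen (fun a b => R a b ∧ a ∈ X ∧ b ∈ X) z y := by
      intro y hy
      induction hy with
      | single hab => exact ⟨h _ _ hab hzX, .single ⟨hab, hzX, h _ _ hab hzX⟩⟩
      | tail _ hab ih => exact ⟨h _ _ hab ih.1, .tail ih.2 ⟨hab, ih.1, h _ _ hab ih.1⟩⟩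
    exact (this z hz).2
  · right
    have : ∀ y, TransGen R y z → y ∉ X ∧ TransGen (fun a b => R a b ∧ a ∉ X ∧ b ∉ X) y z := by
      intro y hy
      induction hy using TransGen.head_induction_on with
      | single hab =>
        have := fun g => hzX (h _ _ hab g)
        exact ⟨this, .single ⟨hab, this, hzX⟩⟩
      | head hab _ ih =>
        have := fun g => ih.1 (h _ _ hab g)
        exact ⟨this, .head ⟨hab, this, ih.1⟩ ih.2⟩
    exact (this z hz).2

lemma glue (m : ℕ) (E : ℕ → ℕ → Prop) (A B : Set ℕ) (u v w : ℕ) (hAB : ∀ a ∈ A, a ∉ B)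
    (hvA : v ∉ A) (hvB : v ∉ B) (hu : u ∈ A) (hw : w ∈ B) (huv : E u v)
    (hE : ∀ a b, E a b → (a ∈ insert v A ∧ b ∈ insert v A) ∨
      (a ∈ insert v B ∧ b ∈ insert v B) ∨ (a = u ∧ b = w))
    (hloop : ∀ a b, E a b → a ≠ b)
    (φA φB : ℕ → Fin (m + 1))
    (hA : Good (fun a b => E a b ∧ a ∈ insert v A ∧ b ∈ insert v A) φA)
    (hB : Good (fun a b => E a b ∧ a ∈ insert v B ∧ b ∈ insert v B) φB) :
    ∃ φ : ℕ → Fin (m + 1), Good E φ := by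
  classical
  let φ : ℕ → Fin (m + 1) := fun a => if a ∈ B then φB a + (φA v - φB v) else φA a
  have eA : ∀ a ∈ insert v A, φ a = φA a := by
    intro a ha
    rcases ha with rfl | ha
    · simp [φ, hvB]
    · simp [φ, hAB a ha]
  have eB : ∀ a ∈ insert v B, φ a = φB a + (φA v - φB v) := by
    intro a ha
    rcases ha with rfl | ha
    · simp [φ, hvB]
    · simp [φ, ha]
  refine ⟨φ, ?_⟩
  let RA : ℕ → ℕ → Prop := fun a b => (E a b ∧ a ∈ insert v A ∧ b ∈ insert v A) ∧ φA a = φA b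
  let RB : ℕ → ℕ → Prop := fun a b => (E a b ∧ a ∈ insert v B ∧ b ∈ insert v B) ∧
    φB a + (φA v - φB v) = φB b + (φA v - φB v)
  have hB' := hB.shift (φA v - φB v)
  let f : ℕ → ℕ := fun a => if a ∈ B then v else a
  have fA : ∀ a ∈ insert v A, f a = a := by
    intro a ha
    rcases ha with rfl | ha
    · simp [f]
    · simp [f, hAB a ha]
  have fB : ∀ a ∈ insert v B, f a = v := by
    intro a ha
    rcases ha with rfl | ha
    · simp [f]
    · simp [f, ha]
  have main : ∀ z z', TransGen (fun a b => (E a b ∧ φ a = φ b) ∧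
      (a = u → b = w → φA u = φA v)) z z' →
      TransGen RA (f z) (f z') ∨ (f z = f z' ∧ TransGen RB z z') := by
    have step : ∀ a b, ((E a b ∧ φ a = φ b) ∧ (a = u → b = w → φA u = φA v)) →
        RA (f a) (f b) ∨ (f a = f b ∧ RB a b) := by
      rintro a b ⟨⟨hab, hφ⟩, huw⟩
      rcases hE a b hab with ⟨ha, hb⟩ | ⟨ha, hb⟩ | ⟨rfl, rfl⟩
      · left
        rw [fA a ha, fA b hb]
        refine ⟨⟨hab, ha, hb⟩, ?_⟩
        rw [← eA a ha, ← eA b hb, hφ]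
      · right
        refine ⟨by rw [fB a ha, fB b hb], ⟨hab, ha, hb⟩, ?_⟩
        rw [← eB a ha, ← eB b hb, hφ]
      · left
        rw [fA a (.inr hu), fB b (.inr hw)]
        exact ⟨⟨huv, .inr hu, .inl rfl⟩, huw rfl rfl⟩
    intro z z' h
    induction h with
    | single hab =>
      rcases step _ _ hab with h | h
      · exact .inl (.single h)
      · exact .inr ⟨h.1, .single h.2⟩
    | tail _ hab ih =>
      rcases step _ _ hab with h | h <;> rcases ih with ih | ih
      · exact .inl (.tail ih h)
      · exact .inl (by rw [ih.1]; exact .single h)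
      · exact .inl (by rw [← h.1]; exact ih)
      · exact .inr ⟨ih.1.trans h.1, .tail ih.2 h.2⟩
  intro z hz
  have hz' : TransGen (fun a b => (E a b ∧ φ a = φ b) ∧ (a = u → b = w → φA u = φA v)) z z := by
    by_cases huvc : φA u = φA v
    · exact tmono (fun a b hab => ⟨hab, fun _ _ => huvc⟩) hz
    · have hn := noleave (fun a b => E a b ∧ φ a = φ b) {a | a ∈ B ∧ φ a = φA u} (by
        rintro a b ⟨hab, hφ⟩ ⟨ha, hac⟩
        refine ⟨?_, by rw [← hφ]; exact hac⟩
        rcases hE a b hab with ⟨ha', hb⟩ | ⟨ha', hb⟩ | ⟨rfl, rfl⟩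
        · rcases ha' with rfl | ha'
          · exact absurd ha hvB
          · exact absurd ha (hAB a ha')
        · rcases hb with rfl | hb
          · exfalso
            apply huvc
            rw [← hac, hφ, eA b (.inl rfl)]
          · exact hb
        · exact hw) z hz
      have hcol : φ u = φA u := eA u (.inr hu)
      rcases hn with hn | hn
      · refine tmono (fun a b hab => ⟨hab.1, ?_⟩) hn
        rintro rfl rfl
        exact absurd hab.2.1.1 (hAB _ hu)
      · refine tmono (fun a b hab => ⟨hab.1, ?_⟩) hn
        rintro rfl rfl
        exact absurd ⟨hw, by rw [← hab.1.2, hcol]⟩ hab.2.2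
  rcases main z z hz' with h | ⟨_, h⟩
  · exact hA _ h
  · exact hB' _ h

/-- A minimal non-`k`-dicolourable set of arcs has all its cuts of size at least `k`. -/
lemma crit_cut (m : ℕ) (F : Finset (ℕ × ℕ))
    (hF : ¬ ∃ φ : ℕ → Fin (m + 1), Good (fun a b => (a, b) ∈ F) φ)
    (hmin : ∀ G ⊂ F, ∃ φ : ℕ → Fin (m + 1), Good (fun a b => (a, b) ∈ G) φ)
    (X : Finset ℕ) (hX1 : ∃ a ∈ F, a.1 ∈ X ∨ a.2 ∈ X) (hX2 : ∃ a ∈ F, a.1 ∉ X ∨ a.2 ∉ X) :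
    m + 1 ≤ cut F X := by
  by_contra hlt
  push Not at hlt
  have ss1 : F.filter (fun a => a.1 ∈ X ∧ a.2 ∈ X) ⊂ F := by
    rw [Finset.filter_ssubset]
    obtain ⟨a, ha, h⟩ := hX2
    exact ⟨a, ha, by tauto⟩
  have ss2 : F.filter (fun a => a.1 ∉ X ∧ a.2 ∉ X) ⊂ F := by
    rw [Finset.filter_ssubset]
    obtain ⟨a, ha, h⟩ := hX1
    exact ⟨a, ha, by tauto⟩
  obtain ⟨φ1, h1⟩ := hmin _ ss1
  obtain ⟨φ2, h2⟩ := hmin _ ss2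
  let C := F.filter fun a => a.1 ∈ X ∧ a.2 ∉ X
  have : ∃ s : Fin (m + 1), s ∉ C.image fun a => φ1 a.1 - φ2 a.2 := by
    by_contra hcon
    push Not at hcon
    have h3 : (Finset.univ : Finset (Fin (m + 1))) ⊆ C.image fun a => φ1 a.1 - φ2 a.2 :=
      fun s _ => hcon s
    have h4 := (Finset.card_le_card h3).trans Finset.card_image_le
    simp only [Finset.card_univ, Fintype.card_fin] at h4
    exact absurd h4 (by simpa [cut, C] using hlt)
  obtain ⟨s, hs⟩ := this
  apply hF
  let φ : ℕ → Fin (m + 1) := fun a => if a ∈ X then φ1 a else φ2 a + s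
  refine ⟨φ, fun z hz => ?_⟩
  have hn := noleave _ (X : Set ℕ) (by
    rintro a b ⟨hab, hφ⟩ ha
    by_contra hb
    apply hs
    rw [Finset.mem_coe] at ha hb
    rw [Finset.mem_image]
    refine ⟨(a, b), by simp [C, hab, ha, hb], ?_⟩
    simp only [φ, ha, hb, if_true, if_false] at hφ
    simp [hφ]) z hz
  rcases hn with hn | hn
  · refine h1 z (tmono ?_ hn)
    rintro a b ⟨⟨hab, hφ⟩, ha, hb⟩
    rw [Finset.mem_coe] at ha hb
    simp only [φ, ha, hb, if_true] at hφ
    exact ⟨by simp [hab, ha, hb], hφ⟩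
  · refine h2 z (tmono ?_ hn)
    rintro a b ⟨⟨hab, hφ⟩, ha, hb⟩
    rw [Finset.mem_coe] at ha hb
    simp only [φ, ha, hb, if_false] at hφ
    exact ⟨by simp [hab, ha, hb], add_right_cancel hφ⟩

/-- Proper subdigraphs of extremal digraphs missing a vertex are `k`-dicolourable. -/
lemma proper (m : ℕ) (D : Dgraph) (hWF : D.WF) (hext : Extremal (m + 1) D)
    (F0 : Finset (ℕ × ℕ)) (hF0 : F0 ⊆ D.arcs) (z0 : ℕ) (hz0 : z0 ∈ D.verts)
    (hz0F : ∀ a ∈ F0, a.1 ≠ z0 ∧ a.2 ≠ z0) :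
    ∃ φ : ℕ → Fin (m + 1), Good (fun a b => (a, b) ∈ F0) φ := by
  classical
  by_contra hcon
  obtain ⟨⟨hconn, hbic⟩, hstr, hchi, hlam⟩ := hext
  let T := F0.powerset.filter fun G => ¬ ∃ φ : ℕ → Fin (m + 1), Good (fun a b => (a, b) ∈ G) φ
  obtain ⟨F, hF, hFmin⟩ := Finset.exists_min_image T Finset.card
    ⟨F0, by simp only [T, Finset.mem_filter, Finset.mem_powerset]; exact ⟨subset_rfl, hcon⟩⟩
  simp only [T, Finset.mem_filter, Finset.mem_powerset] at hF
  obtain ⟨hFF0, hFbad⟩ := hF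
  have hmin : ∀ G ⊂ F, ∃ φ : ℕ → Fin (m + 1), Good (fun a b => (a, b) ∈ G) φ := by
    intro G hG
    by_contra hbad
    have := hFmin G (by
      simp only [T, Finset.mem_filter, Finset.mem_powerset]
      exact ⟨hG.subset.trans hFF0, hbad⟩)
    exact absurd (Finset.card_lt_card hG) (by omega)
  have hFD : F ⊆ D.arcs := hFF0.trans hF0
  let H : ℕ → Prop := fun z => ∃ a ∈ F, a.1 = z ∨ a.2 = z
  have hHV : ∀ z, H z → z ∈ D.verts := by
    rintro z ⟨a, ha, rfl | rfl⟩
    · exact (hWF a (hFD ha)).1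
    · exact (hWF a (hFD ha)).2.1
  have hFne : F.Nonempty := by
    by_contra hne
    rw [Finset.not_nonempty_iff_eq_empty] at hne
    apply hFbad
    refine ⟨fun _ => 0, fun z hz => ?_⟩
    rw [TransGen.head'_iff] at hz
    obtain ⟨b, hb, _⟩ := hz
    simp [hne] at hb
  obtain ⟨⟨p, q⟩, hpq⟩ := hFne
  have hp : H p := ⟨_, hpq, .inl rfl⟩
  have hq : H q := ⟨_, hpq, .inr rfl⟩
  have hpq' : p ≠ q := (hWF _ (hFD hpq)).2.2
  let R : ℕ → ℕ → Prop := fun a b => (a, b) ∈ D.arcs ∧ (a, b) ∉ F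
  -- no ear
  have noear : ∀ x y, H x → H y → ReflTransGen R x y → x = y := by
    intro x y hx hy hxy
    by_contra hne
    have : m + 1 + 1 ≤ D.lam := by
      apply le_lam D hWF x y _ hne (hHV x hx) (hHV y hy)
      intro X _ hxX hyX
      have h1 : m + 1 ≤ cut F X := by
        apply crit_cut m F hFbad hmin
        · obtain ⟨a, ha, rfl | rfl⟩ := hx
          · exact ⟨a, ha, .inl hxX⟩
          · exact ⟨a, ha, .inr hxX⟩
        · obtain ⟨a, ha, rfl | rfl⟩ := hy
          · exact ⟨a, ha, .inl hyX⟩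
          · exact ⟨a, ha, .inr hyX⟩
      have h2 : ∃ a b, R a b ∧ a ∈ X ∧ b ∉ X := by
        by_contra hno
        push Not at hno
        apply hyX
        clear hne hy hyX
        induction hxy with
        | refl => exact hxX
        | tail _ hab ih => exact hno _ _ hab ih
      obtain ⟨a, b, hab, ha, hb⟩ := h2
      have := cut_sdiff hFD X hab.1 hab.2 ha hb
      omega
    omega
  have hreachD : ∀ x ∈ D.verts, ∀ y ∈ D.verts,
      ReflTransGen (fun a b => (a, b) ∈ D.arcs) x y := by
    intro x hx y hy
    by_cases hxy : x = y
    · rw [hxy]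
    · obtain ⟨l, h1, h2, h3, h4, h5⟩ := hstr x hx y hy hxy
      exact reach_of_chain _ l x y h5 h2 h3
  have hfrom : ∀ z ∈ D.verts, ∃ h, H h ∧ ReflTransGen R h z := by
    intro z hz
    have := hreachD p (hHV p hp) z hz
    clear hz
    induction this with
    | refl => exact ⟨p, hp, .refl⟩
    | tail _ hab ih =>
      rename_i b c _
      by_cases hbc : (b, c) ∈ F
      · exact ⟨c, ⟨_, hbc, .inr rfl⟩, .refl⟩
      · obtain ⟨h, hh, hr⟩ := ih
        exact ⟨h, hh, .tail hr ⟨hab, hbc⟩⟩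
  have hto : ∀ z ∈ D.verts, ∃ h, H h ∧ ReflTransGen R z h := by
    intro z hz
    have := hreachD z hz p (hHV p hp)
    clear hz
    induction this using ReflTransGen.head_induction_on with
    | refl => exact ⟨p, hp, .refl⟩
    | head hab _ ih =>
      rename_i b c _
      by_cases hbc : (b, c) ∈ F
      · exact ⟨b, ⟨_, hbc, .inl rfl⟩, .refl⟩
      · obtain ⟨h, hh, hr⟩ := ih
        exact ⟨h, hh, .head ⟨hab, hbc⟩ hr⟩
  obtain ⟨h0, hh0, hr0⟩ := hfrom z0 hz0
  have hz0H : ¬ H z0 := by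
    rintro ⟨a, ha, h | h⟩
    · exact (hz0F a (hFF0 ha)).1 h
    · exact (hz0F a (hFF0 ha)).2 h
  have hz0h0 : z0 ≠ h0 := by rintro rfl; exact hz0H hh0
  have hconn0 : (D.delVert h0).UConnected := by
    by_contra hno
    exact hbic h0 ⟨hHV h0 hh0, hno⟩
  obtain ⟨y, hy, hyh0⟩ : ∃ y, H y ∧ y ≠ h0 := by
    by_cases h : p = h0
    · exact ⟨q, hq, fun h' => hpq' (h.trans h'.symm)⟩
    · exact ⟨p, hp, h⟩
  have hr : (D.delVert h0).UReach z0 y := by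
    apply hconn0.2
    · simp [delVert, induce, hz0, hz0h0]
    · simp [delVert, induce, hHV y hy, hyh0]
  have inv : ∀ z, ReflTransGen (D.delVert h0).adj z0 z → ¬ H z ∧ ReflTransGen R h0 z := by
    intro z hz
    induction hz with
    | refl => exact ⟨hz0H, hr0⟩
    | tail _ hab ih =>
      rename_i b c _
      obtain ⟨hbH, hbr⟩ := ih
      have h1 : c ≠ h0 ∧ ((b, c) ∈ D.arcs ∨ (c, b) ∈ D.arcs) := by
        rcases hab with hab | hab <;>
          simp only [delVert, induce, Finset.mem_filter, Finset.mem_erase] at hab <;> tauto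
      obtain ⟨hc, hbc⟩ := h1
      have hcr : ReflTransGen R h0 c := by
        rcases hbc with hbc | hbc
        · exact .tail hbr ⟨hbc, fun hF => hbH ⟨_, hF, .inl rfl⟩⟩
        · have hcb : R c b := ⟨hbc, fun hF => hbH ⟨_, hF, .inr rfl⟩⟩
          obtain ⟨h1, hh1, hr1⟩ := hfrom c (hWF _ hbc).1
          obtain ⟨h2, hh2, hr2⟩ := hto b (hWF _ hbc).2.1
          have e1 := noear h1 h2 hh1 hh2 ((hr1.tail hcb).trans hr2)
          have e2 := noear h0 h2 hh0 hh2 (hbr.trans hr2)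
          rw [e2, ← e1]; exact hr1
      exact ⟨fun hcH => hc (noear h0 c hh0 hcH hcr).symm, hcr⟩
  exact (inv y hr).1 hy

end S10


/-- Lemma 5.4: if D is k-extremal, uw ∈ A(D) and D − uw has a
cutvertex v, then D is a directed Hajós join of two digraphs with respect to
(uv, vw). -/
theorem statement_10 (k : ℕ) (hk : 1 ≤ k) (D : Dgraph) (hWF : D.WF)
    (hext : Extremal k D) (u w : ℕ) (huw : (u, w) ∈ D.arcs)
    (v : ℕ) (hcut : (D.delArcs {(u, w)}).IsCutvertex v) :
    ∃ D1 D2 v1 v2, IsDirHajosJoinAt D D1 D2 u v1 v2 w v := by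
  classical
  obtain ⟨m, rfl⟩ : ∃ m, k = m + 1 := ⟨k - 1, by omega⟩
  obtain ⟨hvV, hdis⟩ := hcut
  have hvV : v ∈ D.verts := hvV
  have hcon : (D.delVert v).UConnected := by
    by_contra h
    exact hext.1.2 v ⟨hvV, h⟩
  set G := (D.delArcs {(u, w)}).delVert v with hG
  have hGarc : ∀ a b, (a, b) ∈ G.arcs ↔ (a, b) ∈ D.arcs ∧ (a, b) ≠ (u, w) ∧ a ≠ v ∧ b ≠ v := by
    intro a b
    simp only [hG, delVert, induce, delArcs, Finset.mem_filter, Finset.mem_sdiff,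
      Finset.mem_singleton, Finset.mem_erase]
    constructor
    · tauto
    · rintro ⟨h1, h2, h3, h4⟩
      have := hWF _ h1
      exact ⟨⟨h1, h2⟩, ⟨h3, this.1⟩, ⟨h4, this.2.1⟩⟩
  have hsymm : ∀ a b, G.adj a b → G.adj b a := fun a b h => h.symm
  have key : u ≠ v ∧ w ≠ v ∧ ¬ G.UReach u w := by
    by_contra hbad
    apply hdis
    refine ⟨hcon.1, ?_⟩
    intro a ha b hb
    have hab := hcon.2 a ha b hb
    have hsr : ∀ x y, G.UReach x y → G.UReach y x := by
      intro x y h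
      induction h with
      | refl => exact .refl
      | tail _ hab ih => exact .head (hsymm _ _ hab) ih
    have step : ∀ x y, (x, y) ∈ (D.delVert v).arcs → G.UReach x y := by
      intro x y hxy
      simp only [delVert, induce, Finset.mem_filter, Finset.mem_erase] at hxy
      by_cases he : (x, y) = (u, w)
      · have : x = u ∧ y = w := by simpa using he
        obtain ⟨rfl, rfl⟩ := this
        by_contra hno
        exact hbad ⟨hxy.2.1.1, hxy.2.2.1, hno⟩
      · exact .single (.inl ((hGarc x y).mpr ⟨hxy.1, he, hxy.2.1.1, hxy.2.2.1⟩))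
    clear ha hb
    induction hab with
    | refl => exact .refl
    | tail _ h ih =>
      rcases h with h | h
      · exact ih.trans (step _ _ h)
      · exact ih.trans (hsr _ _ (step _ _ h))
  obtain ⟨huv, hwv, hnr⟩ := key
  let A : Finset ℕ := (D.verts.erase v).filter fun z => G.UReach u z
  let B : Finset ℕ := (D.verts.erase v).filter fun z => ¬ G.UReach u z
  have huA : u ∈ A := by
    simp only [A, Finset.mem_filter, Finset.mem_erase]
    exact ⟨⟨huv, (hWF _ huw).1⟩, .refl⟩
  have hwB : w ∈ B := by
    simp only [B, Finset.mem_filter, Finset.mem_erase]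
    exact ⟨⟨hwv, (hWF _ huw).2.1⟩, hnr⟩
  have hvA : v ∉ A := by simp [A]
  have hvB : v ∉ B := by simp [B]
  have hAB : ∀ a ∈ A, a ∉ B := by
    intro a ha hb
    exact (Finset.mem_filter.mp hb).2 (Finset.mem_filter.mp ha).2
  have hAV : ∀ a ∈ A, a ∈ D.verts := fun a ha =>
    Finset.mem_of_mem_erase (Finset.mem_filter.mp ha).1
  have hBV : ∀ a ∈ B, a ∈ D.verts := fun a ha =>
    Finset.mem_of_mem_erase (Finset.mem_filter.mp ha).1
  have hcover : ∀ a ∈ D.verts, a = v ∨ a ∈ A ∨ a ∈ B := by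
    intro a ha
    simp only [A, B, Finset.mem_filter, Finset.mem_erase]
    tauto
  have hE : ∀ a b, (a, b) ∈ D.arcs → (a ∈ insert v A ∧ b ∈ insert v A) ∨
      (a ∈ insert v B ∧ b ∈ insert v B) ∨ (a = u ∧ b = w) := by
    intro a b hab
    by_cases he : (a, b) = (u, w)
    · right; right; simpa using he
    have h1 := hcover a (hWF _ hab).1
    have h2 := hcover b (hWF _ hab).2.1
    simp only [Finset.mem_insert]
    by_cases ha : a = v
    · rcases h2 with h2 | h2 | h2
      · exact .inl ⟨.inl ha, .inl h2⟩
      · exact .inl ⟨.inl ha, .inr h2⟩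
      · exact .inr (.inl ⟨.inl ha, .inr h2⟩)
    by_cases hb : b = v
    · rcases h1 with h1 | h1 | h1
      · exact absurd h1 ha
      · exact .inl ⟨.inr h1, .inl hb⟩
      · exact .inr (.inl ⟨.inr h1, .inl hb⟩)
    have hg := (hGarc a b).mpr ⟨hab, he, ha, hb⟩
    have : G.UReach u a ↔ G.UReach u b :=
      ⟨fun h => h.tail (.inl hg), fun h => h.tail (.inr hg)⟩
    rcases h1 with h1 | h1 | h1
    · exact absurd h1 ha
    · rcases h2 with h2 | h2 | h2
      · exact absurd h2 hb
      · exact .inl ⟨.inr h1, .inr h2⟩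
      · exact absurd (this.mp (Finset.mem_filter.mp h1).2) (Finset.mem_filter.mp h2).2
    · rcases h2 with h2 | h2 | h2
      · exact absurd h2 hb
      · exact absurd (this.mpr (Finset.mem_filter.mp h2).2) (Finset.mem_filter.mp h1).2
      · exact .inr (.inl ⟨.inr h1, .inr h2⟩)
  have hbad : ¬ ∃ φ : ℕ → Fin (m + 1), S10.Good (fun a b => (a, b) ∈ D.arcs) φ := by
    rintro ⟨φ, hφ⟩
    have h1 : D.dichi ≤ m + 1 := Nat.sInf_le ⟨φ, hφ.isDicolouring⟩
    have := hext.2.2.1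
    omega
  have hcolA : ∃ φ : ℕ → Fin (m + 1), S10.Good (fun a b => (a, b) ∈ D.arcs ∧
      a ∈ insert v (A : Set ℕ) ∧ b ∈ insert v (A : Set ℕ)) φ := by
    obtain ⟨φ, hφ⟩ := S10.proper m D hWF hext
      (D.arcs.filter fun a => a.1 ∈ insert v A ∧ a.2 ∈ insert v A) (Finset.filter_subset _ _)
      w (hBV w hwB) (by
        intro a ha
        have hw' : w ∉ insert v A := by
          simp only [Finset.mem_insert, not_or]
          exact ⟨hwv, fun h => hAB w h hwB⟩
        have := (Finset.mem_filter.mp ha).2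
        exact ⟨fun h => hw' (h ▸ this.1), fun h => hw' (h ▸ this.2)⟩)
    exact ⟨φ, hφ.mono (fun a b h => by simpa using h)⟩
  have hcolB : ∃ φ : ℕ → Fin (m + 1), S10.Good (fun a b => (a, b) ∈ D.arcs ∧
      a ∈ insert v (B : Set ℕ) ∧ b ∈ insert v (B : Set ℕ)) φ := by
    obtain ⟨φ, hφ⟩ := S10.proper m D hWF hext
      (D.arcs.filter fun a => a.1 ∈ insert v B ∧ a.2 ∈ insert v B) (Finset.filter_subset _ _)
      u (hAV u huA) (by
        intro a ha
        have hu' : u ∉ insert v B := by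
          simp only [Finset.mem_insert, not_or]
          exact ⟨huv, hAB u huA⟩
        have := (Finset.mem_filter.mp ha).2
        exact ⟨fun h => hu' (h ▸ this.1), fun h => hu' (h ▸ this.2)⟩)
    exact ⟨φ, hφ.mono (fun a b h => by simpa using h)⟩
  obtain ⟨φA, hφA⟩ := hcolA
  obtain ⟨φB, hφB⟩ := hcolB
  have hnuv : (u, v) ∉ D.arcs := by
    intro h
    apply hbad
    refine S10.glue m (fun a b => (a, b) ∈ D.arcs) A B u v w (by simpa using hAB)
      (by simpa using hvA) (by simpa using hvB) (by simpa using huA) (by simpa using hwB) h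
      ?_ (fun a b hab => (hWF _ hab).2.2) φA φB hφA hφB
    intro a b hab
    simpa using hE a b hab
  have hnvw : (v, w) ∉ D.arcs := by
    intro h
    apply hbad
    obtain ⟨φ, hφ⟩ := S10.glue m (fun a b => (b, a) ∈ D.arcs) B A w v u
      (by intro a ha hb; exact hAB a (by simpa using hb) (by simpa using ha))
      (by simpa using hvB) (by simpa using hvA) (by simpa using hwB) (by simpa using huA) h
      (by
        intro a b hab
        have := hE b a hab
        simp only [Finset.mem_insert] at this
        simp only [Set.mem_insert_iff, Finset.mem_coe]
        tauto) (fun a b hab => (hWF _ hab).2.2.symm) φB φA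
      (hφB.swap.mono (fun a b h => ⟨h.1, h.2.2, h.2.1⟩))
      (hφA.swap.mono (fun a b h => ⟨h.1, h.2.2, h.2.1⟩))
    exact ⟨φ, hφ.swap⟩
  -- the construction
  obtain ⟨v2, hv2⟩ : ∃ v2, v2 ∉ D.verts := Infinite.exists_notMem_finset D.verts
  have hv2v : v2 ≠ v := by rintro rfl; exact hv2 hvV
  have hv2A : v2 ∉ A := fun h => hv2 (hAV _ h)
  have hv2B : v2 ∉ B := fun h => hv2 (hBV _ h)
  have hB2 : ∀ a ∈ insert v B, a ≠ v2 := by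
    rintro a ha rfl
    rcases Finset.mem_insert.mp ha with h | h
    · exact hv2v h
    · exact hv2B h
  have hrr : ∀ a, a ≠ v2 → ren v2 v (ren v v2 a) = a := by
    intro a ha
    unfold ren
    by_cases h : a = v <;> simp [h, ha]
  have hrB : ∀ a ∈ insert v B, ren v v2 a ∈ insert v2 B := by
    intro a ha
    unfold ren
    rcases Finset.mem_insert.mp ha with h | h
    · simp [h]
    · rw [if_neg (by rintro rfl; exact hvB h)]; simp [h]
  let FA := D.arcs.filter fun a => a.1 ∈ insert v A ∧ a.2 ∈ insert v A
  let FB := D.arcs.filter fun a => a.1 ∈ insert v B ∧ a.2 ∈ insert v B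
  have hinv : ∀ a ∈ FB, renArc v2 v (renArc v v2 a) = a := by
    rintro ⟨a, b⟩ hab
    have := (Finset.mem_filter.mp hab).2
    simp only [renArc, hrr a (hB2 a this.1), hrr b (hB2 b this.2)]
  have hidA : ∀ a ∈ FA, renArc v2 v a = a := by
    rintro ⟨a, b⟩ hab
    have h := (Finset.mem_filter.mp hab)
    have h1 : a ≠ v2 := fun h' => hv2 (h' ▸ (hWF _ h.1).1)
    have h2 : b ≠ v2 := fun h' => hv2 (h' ▸ (hWF _ h.1).2.1)
    simp [renArc, ren, h1, h2]
  have hid : ∀ a : ℕ × ℕ, renArc v v a = a := by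
    rintro ⟨a, b⟩
    simp only [renArc, ren, Prod.mk.injEq]
    constructor <;> split_ifs <;> simp_all
  have hFAn : (u, v) ∉ FA := fun h => hnuv (Finset.mem_filter.mp h).1
  have hFBn : (v2, w) ∉ FB.image (renArc v v2) := by
    intro h
    obtain ⟨a, ha, he⟩ := Finset.mem_image.mp h
    have h1 := hinv a ha
    rw [he] at h1
    have hwv2 : w ≠ v2 := hB2 w (by simp [hwB])
    have h2 : a = (v, w) := by rw [← h1]; simp [renArc, ren, hwv2]
    exact hnvw (h2 ▸ (Finset.mem_filter.mp ha).1)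
  refine ⟨⟨insert v A, insert (u, v) FA⟩, ⟨insert v2 B, insert (v2, w) (FB.image (renArc v v2))⟩,
    v, v2, ?_, ?_, ?_, ?_, ?_, ?_, ?_, ?_⟩
  · intro a ha
    rcases Finset.mem_insert.mp ha with rfl | ha
    · simp [huA, huv]
    · have h := Finset.mem_filter.mp ha
      exact ⟨h.2.1, h.2.2, (hWF _ h.1).2.2⟩
  · intro a ha
    rcases Finset.mem_insert.mp ha with rfl | ha
    · simp only [Finset.mem_insert, hwB, true_or, or_true, true_and]
      rintro rfl; exact hv2B hwB
    · obtain ⟨b, hb, rfl⟩ := Finset.mem_image.mp ha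
      have h := Finset.mem_filter.mp hb
      refine ⟨hrB _ h.2.1, hrB _ h.2.2, ?_⟩
      intro he
      have h1 := hrr b.1 (hB2 _ h.2.1)
      have h2 := hrr b.2 (hB2 _ h.2.2)
      apply (hWF _ h.1).2.2
      rw [← h1, ← h2]
      exact congrArg _ he
  · rw [Finset.disjoint_left]
    intro a ha hb
    rcases Finset.mem_insert.mp ha with rfl | ha <;> rcases Finset.mem_insert.mp hb with h | hb
    · exact hv2v h.symm
    · exact hvB hb
    · exact hv2A (h ▸ ha)
    · exact hAB a ha hb
  · simp
  · simp
  · simp [hvA, hvB, hv2v.symm]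
  · simp only [Finset.erase_insert hvA, Finset.erase_insert hv2B]
    ext a
    simp only [Finset.mem_insert, Finset.mem_union]
    constructor
    · exact hcover a
    · rintro (rfl | h | h)
      · exact hvV
      · exact hAV a h
      · exact hBV a h
  · simp only [Finset.erase_insert hFAn, Finset.erase_insert hFBn, hid]
    rw [Finset.image_union, Finset.image_image]
    have e1 : FA.image (fun a => renArc v2 v a) = FA := by
      rw [Finset.image_congr (g := id) (fun a ha => hidA a ha), Finset.image_id]
    have e2 : FB.image ((fun a => renArc v2 v a) ∘ renArc v v2) = FB := by
      exact (Finset.image_congr (g := id) (fun a ha => hinv a ha)).trans Finset.image_id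
    rw [e1, e2]
    ext ⟨a, b⟩
    simp only [Finset.mem_insert, Finset.mem_union, FA, FB, Finset.mem_filter]
    constructor
    · intro hab
      have := hE a b hab
      simp only [Finset.mem_insert] at this
      rcases this with h | h | ⟨h1, h2⟩
      · exact .inr (.inl ⟨hab, h⟩)
      · exact .inr (.inr ⟨hab, h⟩)
      · exact .inl (by rw [h1, h2])
    · rintro (h | h | h)
      · rw [h]; exact huw
      · exact h.1
      · exact h.1
end
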